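/- arXiv:0903.1411 — 2 statements merged into one kernel-verified Lean document; each statement's English description precedes it below -/
import Mathlib

section
/- Let n ≥ 1, let A be an invertible symmetric n×n real matrix, and let B(x,y) = ⟨x, Ay⟩ be the associated nondegenerate symmetric bilinear form on ℝⁿ. Let W be a proper linear subspace of ℝⁿ on which B restricts to a nondegenerate form. Let f be a tempered distribution on ℝⁿ and suppose that both f and its B-Fourier transform f̂_B are supported in W, i.e., f(φ) = 0 and f̂_B(φ) = 0 for every smooth compactly supported function φ on ℝⁿ whose support is disjoint from W. Then f = 0. -/
open Matrix MeasureTheory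

open SchwartzMap Filter Topology
open scoped ContDiff LineDeriv FourierTransform

theorem SchwartzMap.exists_seminorm_le_of_eq_comp_mul {E F : Type*}
    [NormedAddCommGroup E] [NormedSpace ℝ E] [NormedAddCommGroup F] [NormedSpace ℝ F]
    (g : 𝓢(F, ℂ)) (φ : 𝓢(E, ℂ)) (k m : ℕ) :
    ∃ C, 0 ≤ C ∧ ∀ (L : E →L[ℝ] F) (K : ℝ), 1 ≤ K → ‖L‖ ≤ K → ∀ ψ : 𝓢(E, ℂ),
      (∀ x, ψ x = g (L x) * φ x) → SchwartzMap.seminorm ℂ k m ψ ≤ C * K ^ m := by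
  refine ⟨∑ i ∈ Finset.range (m + 1), (m.choose i : ℝ) * SchwartzMap.seminorm ℂ 0 i g *
    SchwartzMap.seminorm ℂ k (m - i) φ, by positivity, fun L K hK hL ψ hψ => ?_⟩
  refine SchwartzMap.seminorm_le_bound ℂ k m ψ (by positivity) fun x => ?_
  have hψ' : (ψ : E → ℂ) = fun y => (g ∘ L) y * φ y := funext hψ
  have hcomp : ContDiff ℝ ∞ (g ∘ L) := (g.smooth ⊤).comp L.contDiff
  have hmul := norm_iteratedFDeriv_mul_le (n := m) hcomp (φ.smooth ⊤) x
    (mod_cast le_top)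
  rw [hψ']
  refine (mul_le_mul_of_nonneg_left hmul (by positivity)).trans ?_
  rw [Finset.mul_sum, Finset.sum_mul]
  refine Finset.sum_le_sum fun i hi => ?_
  have him : i ≤ m := Nat.lt_succ_iff.mp (Finset.mem_range.mp hi)
  have hg : ‖iteratedFDeriv ℝ i (g ∘ L) x‖ ≤ SchwartzMap.seminorm ℂ 0 i g * K ^ m := by
    rw [L.iteratedFDeriv_comp_right (g.smooth ⊤) x (mod_cast le_top)]
    refine (ContinuousMultilinearMap.norm_compContinuousLinearMap_le _ _).trans ?_
    rw [Finset.prod_const, Finset.card_univ, Fintype.card_fin]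
    refine mul_le_mul (g.norm_iteratedFDeriv_le_seminorm ℂ i _) ?_ (by positivity) (by positivity)
    exact (pow_le_pow_left₀ (norm_nonneg _) hL i).trans (pow_le_pow_right₀ hK him)
  calc ‖x‖ ^ k * ((m.choose i : ℝ) * ‖iteratedFDeriv ℝ i (g ∘ L) x‖ *
          ‖iteratedFDeriv ℝ (m - i) φ x‖)
      = (m.choose i : ℝ) * ‖iteratedFDeriv ℝ i (g ∘ L) x‖ *
          (‖x‖ ^ k * ‖iteratedFDeriv ℝ (m - i) φ x‖) := by ring
    _ ≤ (m.choose i : ℝ) * (SchwartzMap.seminorm ℂ 0 i g * K ^ m) *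
          SchwartzMap.seminorm ℂ k (m - i) φ := by
        gcongr
        exact φ.le_seminorm ℂ k (m - i) x
    _ = _ := by ring

theorem SchwartzMap.exists_norm_le_finset_sup_seminorm {E : Type*}
    [NormedAddCommGroup E] [NormedSpace ℝ E] (f : 𝓢(E, ℂ) →L[ℂ] ℂ) :
    ∃ (s : Finset (ℕ × ℕ)) (C : ℝ), 0 ≤ C ∧ ∀ (φ : 𝓢(E, ℂ)) (a : ℝ), 0 ≤ a →
      (∀ p ∈ s, SchwartzMap.seminorm ℂ p.1 p.2 φ ≤ a) → ‖f φ‖ ≤ C * a := by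
  obtain ⟨s, C, -, h⟩ := Seminorm.bound_of_continuous (schwartz_withSeminorms ℂ E ℂ)
    ((normSeminorm ℂ ℂ).comp (f : 𝓢(E, ℂ) →ₗ[ℂ] ℂ)) f.continuous.norm
  refine ⟨s, C, C.2, fun φ a ha hs => ?_⟩
  refine (h φ).trans ?_
  exact mul_le_mul_of_nonneg_left (Seminorm.finset_sup_apply_le ha fun p hp => hs p hp) C.2

theorem SchwartzMap.exists_hasCompactSupport_eq_one (E : Type*)
    [NormedAddCommGroup E] [NormedSpace ℝ E] [FiniteDimensional ℝ E] :
    ∃ χ : 𝓢(E, ℂ), HasCompactSupport χ ∧ ∀ x, ‖x‖ ≤ 1 → χ x = 1 := by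
  let b : ContDiffBump (0 : E) := ⟨1, 2, one_pos, one_lt_two⟩
  have hb : HasCompactSupport (Complex.ofRealCLM ∘ b) := b.hasCompactSupport.comp_left rfl
  refine ⟨hb.toSchwartzMap (Complex.ofRealCLM.contDiff.comp b.contDiff), hb, fun x hx => ?_⟩
  have : b x = 1 := b.one_of_mem_closedBall (by simpa [b] using hx)
  simp [this]

theorem eq_zero_of_forall_norm_le_div {z : ℂ} {C : ℝ} (h : ∀ R : ℝ, 1 ≤ R → ‖z‖ ≤ C / R) :
    z = 0 := by
  refine norm_le_zero_iff.mp (ge_of_tendsto (tendsto_const_nhds.div_atTop tendsto_id :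
    Tendsto (fun R : ℝ => C / R) atTop (𝓝 0)) ?_)
  filter_upwards [eventually_ge_atTop 1] with R hR using h R hR

/-- A tempered distribution vanishing on compactly supported functions is zero. -/
theorem SchwartzMap.eq_zero_of_forall_hasCompactSupport {E : Type*}
    [NormedAddCommGroup E] [NormedSpace ℝ E] [FiniteDimensional ℝ E] (f : 𝓢(E, ℂ) →L[ℂ] ℂ)
    (hf : ∀ φ : 𝓢(E, ℂ), HasCompactSupport φ → f φ = 0) : f = 0 := by
  ext φ
  obtain ⟨χ, hχ, hχ1⟩ := SchwartzMap.exists_hasCompactSupport_eq_one E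
  obtain ⟨s, C, hC, hs⟩ := SchwartzMap.exists_norm_le_finset_sup_seminorm f
  choose D hD0 hD using fun p : ℕ × ℕ => χ.exists_seminorm_le_of_eq_comp_mul φ p.1 p.2
  let M : ℝ := ∑ p ∈ s, (SchwartzMap.seminorm ℂ (p.1 + 1) p.2 φ + D (p.1 + 1, p.2))
  have hM (p : ℕ × ℕ) : 0 ≤ SchwartzMap.seminorm ℂ (p.1 + 1) p.2 φ + D (p.1 + 1, p.2) :=
    add_nonneg (apply_nonneg _ _) (hD0 _)
  refine eq_zero_of_forall_norm_le_div (C := C * M) fun R hR => ?_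
  have hR0 : 0 < R := one_pos.trans_le hR
  let L : E →L[ℝ] E := R⁻¹ • ContinuousLinearMap.id ℝ E
  have hL : ‖L‖ ≤ 1 := by
    refine ContinuousLinearMap.opNorm_le_bound _ zero_le_one fun x => ?_
    simp only [L, _root_.smul_apply, ContinuousLinearMap.id_apply, norm_smul,
      norm_inv, Real.norm_of_nonneg hR0.le]
    gcongr
    exact inv_le_one_of_one_le₀ hR
  have hgrowth : (fun x => χ (L x)).HasTemperateGrowth :=
    χ.hasTemperateGrowth.comp L.hasTemperateGrowth
  let ψ : 𝓢(E, ℂ) := smulLeftCLM ℂ (fun x => χ (L x)) φ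
  have hψ (x : E) : ψ x = χ (L x) * φ x := smulLeftCLM_apply_apply hgrowth φ x
  have hψc : HasCompactSupport ψ := by
    have h1 : HasCompactSupport (fun x => χ (L x)) := by
      have := hχ.comp_homeomorph (Homeomorph.smulOfNeZero R⁻¹ (inv_ne_zero hR0.ne') : E ≃ₜ E)
      exact this
    have : (ψ : E → ℂ) = (fun x => χ (L x)) * φ := funext hψ
    rw [this]
    exact h1.mul_right
  have hsub : f φ = f (φ - ψ) := by rw [map_sub, hf ψ hψc, sub_zero]
  rw [hsub, mul_div_assoc]
  refine hs _ _ (div_nonneg (Finset.sum_nonneg fun p _ => hM p) hR0.le) fun p hp => ?_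
  have hle : SchwartzMap.seminorm ℂ (p.1 + 1) p.2 (φ - ψ) ≤ M := by
    refine (map_sub_le_add _ _ _).trans ?_
    refine le_trans ?_ (Finset.single_le_sum (fun q _ => hM q) hp)
    gcongr
    simpa using hD (p.1 + 1, p.2) L 1 le_rfl hL ψ hψ
  have hM0 : 0 ≤ M := Finset.sum_nonneg fun p _ => hM p
  refine SchwartzMap.seminorm_le_bound ℂ _ _ _ (div_nonneg hM0 hR0.le) fun x => ?_
  rcases lt_or_ge ‖x‖ R with hx | hx
  · have h0 : (φ - ψ : 𝓢(E, ℂ)) =ᶠ[𝓝 x] (fun _ => (0 : ℂ)) := by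
      filter_upwards [(isOpen_lt continuous_norm continuous_const).mem_nhds hx] with y hy
      have : χ (L y) = 1 := hχ1 _ (by
        simp only [L, _root_.smul_apply, ContinuousLinearMap.id_apply, norm_smul,
          norm_inv, Real.norm_of_nonneg hR0.le]
        rw [inv_mul_le_iff₀ hR0, mul_one]
        exact le_of_lt hy)
      simp [hψ, this]
    rw [(h0.iteratedFDeriv ℝ p.2).eq_of_nhds]
    simp
    positivity
  · rw [le_div_iff₀ hR0]
    refine le_trans ?_ (((φ - ψ).le_seminorm ℂ (p.1 + 1) p.2 x).trans hle)
    rw [pow_succ]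
    calc _ = ‖x‖ ^ p.1 * R * ‖iteratedFDeriv ℝ p.2 (φ - ψ : 𝓢(E, ℂ)) x‖ := by ring
      _ ≤ _ := by gcongr

theorem SchwartzMap.smulLeftCLM_pow_apply {E : Type*}
    [NormedAddCommGroup E] [NormedSpace ℝ E] {u : E → ℂ}
    (hu : u.HasTemperateGrowth) (k : ℕ) (φ : 𝓢(E, ℂ)) (x : E) :
    ((smulLeftCLM ℂ u) ^ k) φ x = u x ^ k * φ x := by
  induction k with
  | zero => simp
  | succ k ih =>
    rw [pow_succ', mul_apply_eq_comp, smulLeftCLM_apply_apply hu, ih, smul_eq_mul,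
      pow_succ', mul_assoc]

/-- A tempered distribution supported in the kernel of a linear form `ℓ` is annihilated by a power
of `ℓ`. -/
theorem SchwartzMap.exists_pow_smulLeftCLM_eq_zero {E : Type*}
    [NormedAddCommGroup E] [NormedSpace ℝ E] [FiniteDimensional ℝ E] (f : 𝓢(E, ℂ) →L[ℂ] ℂ)
    (ℓ : E →L[ℝ] ℝ)
    (hf : ∀ φ : 𝓢(E, ℂ), HasCompactSupport φ → (∀ x ∈ tsupport φ, ℓ x ≠ 0) → f φ = 0) :
    ∃ N : ℕ, f ∘L (smulLeftCLM ℂ (fun x => (ℓ x : ℂ))) ^ N = 0 := by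
  obtain ⟨χ, hχ, hχ1⟩ := SchwartzMap.exists_hasCompactSupport_eq_one ℝ
  obtain ⟨s, C, hC, hs⟩ := SchwartzMap.exists_norm_le_finset_sup_seminorm f
  let N : ℕ := s.sup Prod.snd + 1
  have hid : (fun t : ℝ => (t : ℂ)).HasTemperateGrowth := Complex.ofRealCLM.hasTemperateGrowth
  have hℓ : (fun x => (ℓ x : ℂ)).HasTemperateGrowth := hid.comp ℓ.hasTemperateGrowth
  let g : 𝓢(ℝ, ℂ) := ((smulLeftCLM ℂ (fun t : ℝ => (t : ℂ))) ^ N) χ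
  have hg (t : ℝ) : g t = (t : ℂ) ^ N * χ t := smulLeftCLM_pow_apply hid N χ t
  refine ⟨N, SchwartzMap.eq_zero_of_forall_hasCompactSupport _ fun φ hφ => ?_⟩
  choose D hD0 hD using fun p : ℕ × ℕ => g.exists_seminorm_le_of_eq_comp_mul φ p.1 p.2
  let M : ℝ := (∑ p ∈ s, D p) * (max 1 ‖ℓ‖) ^ (N - 1)
  have hM : 0 ≤ M := mul_nonneg (Finset.sum_nonneg fun p _ => hD0 p) (by positivity)
  refine eq_zero_of_forall_norm_le_div (C := C * M) fun R hR => ?_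
  have hR0 : 0 < R := one_pos.trans_le hR
  let L : E →L[ℝ] ℝ := R • ℓ
  have hLapp (x : E) : L x = R * ℓ x := rfl
  have hgrowth : (fun x => g (L x)).HasTemperateGrowth :=
    g.hasTemperateGrowth.comp L.hasTemperateGrowth
  let ψ : 𝓢(E, ℂ) := smulLeftCLM ℂ (fun x => g (L x)) φ
  have hψ (x : E) : ψ x = g (L x) * φ x := smulLeftCLM_apply_apply hgrowth φ x
  let Φ : 𝓢(E, ℂ) := ((smulLeftCLM ℂ (fun x => (ℓ x : ℂ))) ^ N) φ
  have hΦ (x : E) : Φ x = (ℓ x : ℂ) ^ N * φ x := smulLeftCLM_pow_apply hℓ N φ x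
  let c : ℂ := ((R : ℂ) ^ N)⁻¹
  have hRC : (R : ℂ) ≠ 0 := mod_cast hR0.ne'
  have hdiff (x : E) : (Φ - c • ψ) x = (ℓ x : ℂ) ^ N * (1 - χ (L x)) * φ x := by
    simp only [_root_.sub_apply, _root_.smul_apply, hΦ, hψ, hg, hLapp, smul_eq_mul, c]
    push_cast
    rw [mul_pow]
    field_simp
  have hf0 : f (Φ - c • ψ) = 0 := by
    refine hf _ ?_ fun x hx hℓx => ?_
    · have : ((Φ - c • ψ : 𝓢(E, ℂ)) : E → ℂ) =
          (fun x => (ℓ x : ℂ) ^ N * (1 - χ (L x))) * φ := funext hdiff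
      rw [this]
      exact hφ.mul_left
    · refine (notMem_tsupport_iff_eventuallyEq.mpr ?_) hx
      have : Tendsto (fun y => ‖L y‖) (𝓝 x) (𝓝 ‖L x‖) := L.continuous.norm.tendsto x
      rw [hLapp, hℓx, mul_zero, norm_zero] at this
      filter_upwards [this.eventually_lt_const one_pos] with y hy
      rw [hdiff, hχ1 _ hy.le]
      simp
  have hfΦ : f Φ = c * f ψ := by
    rw [map_sub, map_smul, sub_eq_zero] at hf0
    simpa using hf0
  change ‖f Φ‖ ≤ _
  have hψle : ‖f ψ‖ ≤ C * (M * R ^ (N - 1)) := by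
    refine hs _ _ (by positivity) fun p hp => ?_
    have hK : 1 ≤ max 1 ‖ℓ‖ * R := one_le_mul_of_one_le_of_one_le (le_max_left _ _) hR
    have hLK : ‖L‖ ≤ max 1 ‖ℓ‖ * R := by
      rw [norm_smul, Real.norm_of_nonneg hR0.le, mul_comm]
      gcongr
      exact le_max_right _ _
    refine (hD p L _ hK hLK ψ hψ).trans ?_
    rw [mul_assoc, ← mul_pow]
    refine mul_le_mul (Finset.single_le_sum (fun q _ => hD0 q) hp) ?_ (by positivity)
      (Finset.sum_nonneg fun p _ => hD0 p)
    exact pow_le_pow_right₀ hK (Finset.le_sup (f := Prod.snd) hp)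
  rw [hfΦ, norm_mul]
  have hc : ‖c‖ = (R ^ N)⁻¹ := by
    simp [c, abs_of_pos hR0]
  rw [hc]
  calc (R ^ N)⁻¹ * ‖f ψ‖ ≤ (R ^ N)⁻¹ * (C * (M * R ^ (N - 1))) := by gcongr
    _ = C * M / R := by
      simp only [N, Nat.add_sub_cancel, pow_succ]
      field_simp

/-- A functional annihilated by powers of two operators satisfying the canonical commutation
relation is zero. -/
theorem eq_zero_of_comp_pow_eq_zero {V : Type*} [AddCommGroup V] [Module ℂ V]
    {L D : Module.End ℂ V} {c : ℂ} (hc : c ≠ 0) (hcomm : D * L = L * D + c • 1) (M N : ℕ)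
    (f : V →ₗ[ℂ] ℂ) (hL : f ∘ₗ L ^ N = 0) (hD : f ∘ₗ D ^ M = 0) : f = 0 := by
  have hpow (j : ℕ) : D * L ^ (j + 1) = L ^ (j + 1) * D + ((j + 1 : ℕ) * c) • L ^ j := by
    induction j with
    | zero => simpa using hcomm
    | succ j ih =>
      rw [pow_succ L (j + 1), ← mul_assoc, ih, add_mul, mul_assoc, hcomm, smul_mul_assoc,
        ← pow_succ, mul_add, mul_smul_comm, mul_one, mul_assoc, add_assoc, ← add_smul]
      congr 2
      push_cast
      ring
  induction M generalizing f N with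
  | zero => exact hD
  | succ M ih =>
    have hfD : f ∘ₗ D = 0 := by
      refine ih (N + 1) (f ∘ₗ D) ?_ ?_
      · rw [LinearMap.comp_assoc, ← Module.End.mul_eq_comp, hpow]
        ext x
        have h0 (y : V) : f ((L ^ N) y) = 0 := LinearMap.congr_fun hL y
        simp [pow_succ, h0]
      · rw [LinearMap.comp_assoc, ← Module.End.mul_eq_comp, ← pow_succ', hD]
    clear hD ih
    induction N with
    | zero => exact hL
    | succ N ih =>
      refine ih ?_
      ext x
      have h1 := LinearMap.congr_fun hL (D x)
      have h2 := LinearMap.congr_fun hfD ((L ^ (N + 1)) x)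
      have h3 := congrArg f (LinearMap.congr_fun (hpow N) x)
      simp only [LinearMap.comp_apply, LinearMap.zero_apply, Module.End.mul_apply,
        LinearMap.add_apply, LinearMap.smul_apply, map_add, map_smul, smul_eq_mul] at h1 h2 h3 ⊢
      rw [h1, h2, zero_add, eq_comm, mul_eq_zero] at h3
      refine h3.resolve_left (mul_ne_zero ?_ hc)
      exact_mod_cast N.succ_ne_zero

theorem Matrix.IsSymm.dotProduct_mulVec_comm {n : ℕ} {A : Matrix (Fin n) (Fin n) ℝ}
    (hA : A.IsSymm) (x y : Fin n → ℝ) : x ⬝ᵥ A.mulVec y = y ⬝ᵥ A.mulVec x := by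
  rw [dotProduct_mulVec, ← mulVec_transpose, hA.eq, dotProduct_comm]

/-- The linear form `x ↦ ⟨x, A v⟩`. -/
noncomputable def Matrix.dotProductMulVecCLM {n : ℕ} (A : Matrix (Fin n) (Fin n) ℝ)
    (v : Fin n → ℝ) : (Fin n → ℝ) →L[ℝ] ℝ :=
  LinearMap.toContinuousLinearMap ((dotProductBilin ℝ ℝ).flip (A.mulVec v))

theorem ContinuousLinearMap.hasTemperateGrowth_ofReal {E : Type*} [NormedAddCommGroup E]
    [NormedSpace ℝ E] (ℓ : E →L[ℝ] ℝ) : (fun x => (ℓ x : ℂ)).HasTemperateGrowth :=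
  (Complex.ofRealCLM ∘L ℓ).hasTemperateGrowth

/-- A nondegenerate symmetric matrix with a proper nondegenerate subspace admits a non-isotropic
vector orthogonal to that subspace. -/
theorem Matrix.exists_orthogonal_dotProduct_mulVec_self_ne_zero {n : ℕ}
    (A : Matrix (Fin n) (Fin n) ℝ) (hA_symm : A.IsSymm) (hA_inv : IsUnit A.det)
    (W : Submodule ℝ (Fin n → ℝ)) (hW_proper : W ≠ ⊤)
    (hW_nondeg : ∀ w ∈ W, (∀ w' ∈ W, w ⬝ᵥ A.mulVec w' = 0) → w = 0) :
    ∃ v, (∀ w ∈ W, w ⬝ᵥ A.mulVec v = 0) ∧ v ⬝ᵥ A.mulVec v ≠ 0 := by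
  let B : LinearMap.BilinForm ℝ (Fin n → ℝ) := Matrix.toBilin' A
  have hB (x y : Fin n → ℝ) : B x y = x ⬝ᵥ A.mulVec y := Matrix.toBilin'_apply' A x y
  have hsymm := hA_symm.dotProduct_mulVec_comm
  have hBrefl : B.IsRefl := fun x y h => by rwa [hB, hsymm, ← hB]
  have hcompl : IsCompl W (B.orthogonal W) := by
    rw [LinearMap.BilinForm.isCompl_orthogonal_iff_disjoint hBrefl, Submodule.disjoint_def]
    refine fun x hx hx' => hW_nondeg x hx fun w hw => ?_
    rw [hsymm, ← hB]
    exact hx' w hw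
  by_contra! h
  have horth (v : Fin n → ℝ) (hv : v ∈ B.orthogonal W) : v ⬝ᵥ A.mulVec v = 0 :=
    h v fun w hw => by rw [← hB]; exact hv w hw
  have hbot : B.orthogonal W = ⊥ := by
    refine (Submodule.eq_bot_iff _).mpr fun v hv => ?_
    have hzero (x : Fin n → ℝ) : x ⬝ᵥ A.mulVec v = 0 := by
      obtain ⟨w, hw, u, hu, rfl⟩ :=
        Submodule.mem_sup.mp (hcompl.sup_eq_top ▸ Submodule.mem_top (x := x))
      have h1 : w ⬝ᵥ A.mulVec v = 0 := by rw [← hB]; exact hv w hw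
      have h2 := horth _ (add_mem hu hv)
      rw [mulVec_add, dotProduct_add, add_dotProduct, add_dotProduct, horth u hu, horth v hv,
        hsymm v u] at h2
      rw [add_dotProduct, h1]
      linarith
    have hAv : A.mulVec v = 0 := dotProduct_self_eq_zero.mp (hzero _)
    exact Matrix.mulVec_injective_of_isUnit ((Matrix.isUnit_iff_isUnit_det A).mpr hA_inv)
      (hAv.trans (mulVec_zero A).symm)
  refine hW_proper ?_
  rw [← hcompl.sup_eq_top, hbot, sup_bot_eq]

/-- The Fourier transform on Schwartz functions with respect to the bilinear form
`(x, y) ↦ ⟨x, A y⟩`, conjugating multiplication by `⟨·, A v⟩` to the derivative along `v`. -/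
theorem SchwartzMap.exists_fourier_bilin {n : ℕ} (A : Matrix (Fin n) (Fin n) ℝ)
    (hA_symm : A.IsSymm) (hA_inv : IsUnit A.det) :
    ∃ T : 𝓢(Fin n → ℝ, ℂ) →L[ℂ] 𝓢(Fin n → ℝ, ℂ), Function.Surjective T ∧
      (∀ φ x, T φ x = ∫ y : Fin n → ℝ,
        φ y * Complex.exp (-(2 * Real.pi * Complex.I) * (x ⬝ᵥ A.mulVec y : ℝ))) ∧
      ∀ v φ, ∂_{v} (T φ) = -(2 * Real.pi * Complex.I) •
        T (smulLeftCLM ℂ (fun x => ((x ⬝ᵥ A.mulVec v : ℝ) : ℂ)) φ) := by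
  have hsymm := hA_symm.dotProduct_mulVec_comm
  let e : EuclideanSpace ℝ (Fin n) ≃L[ℝ] (Fin n → ℝ) := EuclideanSpace.equiv (Fin n) ℝ
  let a : (Fin n → ℝ) ≃L[ℝ] (Fin n → ℝ) :=
    (Matrix.toLinearEquiv' A (Matrix.invertibleOfIsUnitDet A hA_inv)).toContinuousLinearEquiv
  let G : (Fin n → ℝ) ≃L[ℝ] EuclideanSpace ℝ (Fin n) := a.trans e.symm
  have hinner (y : EuclideanSpace ℝ (Fin n)) (x : Fin n → ℝ) :
      inner ℝ y (G x) = e y ⬝ᵥ A.mulVec x := by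
    rw [EuclideanSpace.inner_eq_star_dotProduct, dotProduct_comm]
    rfl
  let T : 𝓢(Fin n → ℝ, ℂ) →L[ℂ] 𝓢(Fin n → ℝ, ℂ) :=
    compCLMOfContinuousLinearEquiv ℂ G ∘L fourierTransformCLM ℂ ∘L
      compCLMOfContinuousLinearEquiv ℂ e
  have hT (φ : 𝓢(Fin n → ℝ, ℂ)) : T φ =
    compCLMOfContinuousLinearEquiv ℂ G (𝓕 (compCLMOfContinuousLinearEquiv ℂ e φ)) := rfl
  refine ⟨T, fun ψ => ?_, fun φ x => ?_, fun v φ => ?_⟩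
  · refine ⟨compCLMOfContinuousLinearEquiv ℂ e.symm
      (𝓕⁻ (compCLMOfContinuousLinearEquiv ℂ G.symm ψ)), ?_⟩
    have h1 (h : 𝓢(EuclideanSpace ℝ (Fin n), ℂ)) : compCLMOfContinuousLinearEquiv ℂ e
        (compCLMOfContinuousLinearEquiv ℂ e.symm h) = h := by
      ext x
      simp
    rw [hT, h1, FourierTransform.fourier_fourierInv_eq]
    ext x
    simp
  · rw [hT, compCLMOfContinuousLinearEquiv_apply, Function.comp_apply, fourier_coe,
      Real.fourier_eq', ← (EuclideanSpace.volume_preserving_symm_measurableEquiv_toLp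
        (Fin n)).integral_comp' (g := fun y : Fin n → ℝ =>
          φ y * Complex.exp (-(2 * Real.pi * Complex.I) * (x ⬝ᵥ A.mulVec y : ℝ)))]
    refine integral_congr_ae (Eventually.of_forall fun y => ?_)
    simp only [hinner]
    rw [smul_eq_mul, mul_comm, hsymm]
    refine congrArg₂ (· * ·) rfl (congrArg Complex.exp ?_)
    change _ = -(2 * Real.pi * Complex.I) * ((x ⬝ᵥ A.mulVec (e y) : ℝ) : ℂ)
    push_cast
    ring
  · have hgrowth : (fun x : Fin n → ℝ => ((x ⬝ᵥ A.mulVec v : ℝ) : ℂ)).HasTemperateGrowth :=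
      (A.dotProductMulVecCLM v).hasTemperateGrowth_ofReal
    rw [hT, lineDerivOp_compCLMOfContinuousLinearEquiv, lineDerivOp_fourier_eq, hT,
      FourierTransform.fourier_smul, map_smul]
    congr 3
    ext y
    have hinnerg : (fun y : EuclideanSpace ℝ (Fin n) => inner ℝ y (G v)).HasTemperateGrowth :=
      ((innerSL ℝ).flip (G v)).hasTemperateGrowth
    rw [smulLeftCLM_apply_apply hinnerg, hinner]
    simp [smulLeftCLM_apply_apply hgrowth]

/-- Uncertainty principle: if a tempered distribution `f` on `ℝⁿ` and its Fourier
transform with respect to a nondegenerate symmetric bilinear form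
`B(x,y) = ⟨x, Ay⟩` are both supported in a proper subspace `W` on which `B` is
nondegenerate, then `f = 0`.  Here the `B`-Fourier transform of `f` is the tempered
distribution `φ ↦ f(φ̂_B)`, with `φ̂_B(x) = ∫ φ(y)·e^{−2πi·B(x,y)} dy`, so the support
assumption on it reads: `f(φ̂_B) = 0` whenever `φ` is a smooth compactly supported
function whose support is disjoint from `W`. -/
theorem fourier_uncertainty {n : ℕ} (hn : 1 ≤ n) (A : Matrix (Fin n) (Fin n) ℝ)
    (hA_symm : A.IsSymm) (hA_inv : IsUnit A.det)
    (W : Submodule ℝ (Fin n → ℝ)) (hW_proper : W ≠ ⊤)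
    (hW_nondeg : ∀ w ∈ W, (∀ w' ∈ W, w ⬝ᵥ A.mulVec w' = 0) → w = 0)
    (f : SchwartzMap (Fin n → ℝ) ℂ →L[ℂ] ℂ)
    (hsupp : ∀ φ : SchwartzMap (Fin n → ℝ) ℂ, HasCompactSupport ⇑φ →
      Disjoint (tsupport ⇑φ) (W : Set (Fin n → ℝ)) → f φ = 0)
    (hsuppFT : ∀ φ φB : SchwartzMap (Fin n → ℝ) ℂ,
      (∀ x, φB x = ∫ y : Fin n → ℝ,
          φ y * Complex.exp (-(2 * Real.pi * Complex.I) * (x ⬝ᵥ A.mulVec y : ℝ))) →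
      HasCompactSupport ⇑φ → Disjoint (tsupport ⇑φ) (W : Set (Fin n → ℝ)) →
      f φB = 0) :
    f = 0 := by
  obtain ⟨v, hvW, hvv⟩ := A.exists_orthogonal_dotProduct_mulVec_self_ne_zero hA_symm hA_inv W
    hW_proper hW_nondeg
  obtain ⟨T, hTsurj, hTint, hTderiv⟩ := SchwartzMap.exists_fourier_bilin A hA_symm hA_inv
  let ℓ : (Fin n → ℝ) →L[ℝ] ℝ := A.dotProductMulVecCLM v
  have hdisj (φ : 𝓢(Fin n → ℝ, ℂ)) (hφ : ∀ x ∈ tsupport φ, ℓ x ≠ 0) :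
      Disjoint (tsupport φ) (W : Set (Fin n → ℝ)) :=
    Set.disjoint_left.mpr fun x hx hxW => hφ x hx (hvW x hxW)
  let L : 𝓢(Fin n → ℝ, ℂ) →L[ℂ] 𝓢(Fin n → ℝ, ℂ) := smulLeftCLM ℂ (fun x => (ℓ x : ℂ))
  have hLapp (φ : 𝓢(Fin n → ℝ, ℂ)) (x : Fin n → ℝ) : L φ x = ℓ x * φ x :=
    smulLeftCLM_apply_apply (ℓ.hasTemperateGrowth_ofReal) φ x
  let D : 𝓢(Fin n → ℝ, ℂ) →L[ℂ] 𝓢(Fin n → ℝ, ℂ) :=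
    LineDeriv.lineDerivOpCLM ℂ 𝓢(Fin n → ℝ, ℂ) v
  obtain ⟨N, hN⟩ := SchwartzMap.exists_pow_smulLeftCLM_eq_zero f ℓ
    fun φ hφ hφ' => hsupp φ hφ (hdisj φ hφ')
  obtain ⟨M, hM⟩ := SchwartzMap.exists_pow_smulLeftCLM_eq_zero (f ∘L T) ℓ
    fun φ hφ hφ' => hsuppFT φ (T φ) (hTint φ) hφ (hdisj φ hφ')
  have hDT (k : ℕ) (φ : 𝓢(Fin n → ℝ, ℂ)) :
      ((D : Module.End ℂ 𝓢(Fin n → ℝ, ℂ)) ^ k) (T φ) =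
        (-(2 * Real.pi * Complex.I)) ^ k • T ((L ^ k) φ) := by
    induction k with
    | zero => simp
    | succ k ih =>
      rw [pow_succ', Module.End.mul_apply, ih, map_smul, pow_succ, mul_smul, pow_succ']
      congr 1
      exact hTderiv v ((L ^ k) φ)
  have hLpow (k : ℕ) (φ : 𝓢(Fin n → ℝ, ℂ)) :
      ((L : Module.End ℂ 𝓢(Fin n → ℝ, ℂ)) ^ k) φ = (L ^ k) φ := by
    induction k with
    | zero => simp
    | succ k ih =>
      rw [pow_succ', Module.End.mul_apply, ih, pow_succ']
      rfl
  have hcomm : (D * L : Module.End ℂ 𝓢(Fin n → ℝ, ℂ)) = L * D + ((ℓ v : ℝ) : ℂ) • 1 := by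
    ext φ x
    have hℓ : HasFDerivAt (fun y => (ℓ y : ℂ)) (Complex.ofRealCLM ∘L ℓ) x :=
      (Complex.ofRealCLM ∘L ℓ).hasFDerivAt
    have hfun : (L φ : (Fin n → ℝ) → ℂ) = fun y => (ℓ y : ℂ) * φ y := funext (hLapp φ)
    change fderiv ℝ (L φ) x v = L (D φ) x + (ℓ v : ℂ) * φ x
    have hmul : HasFDerivAt (fun y => (ℓ y : ℂ) * φ y) _ x := hℓ.mul (φ.hasFDerivAt x)
    rw [hfun, hmul.fderiv, hLapp]
    change (ℓ x : ℂ) * fderiv ℝ φ x v + φ x * (ℓ v : ℂ) = ℓ x * fderiv ℝ φ x v + _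
    ring
  have hf : (f : 𝓢(Fin n → ℝ, ℂ) →ₗ[ℂ] ℂ) = 0 := by
    refine eq_zero_of_comp_pow_eq_zero (c := ((ℓ v : ℝ) : ℂ)) (mod_cast hvv) hcomm M N _ ?_ ?_
    · ext φ
      exact (congrArg f (hLpow N φ)).trans (DFunLike.congr_fun hN φ)
    · ext ψ
      obtain ⟨φ, rfl⟩ := hTsurj ψ
      have h : f (T ((L ^ M) φ)) = 0 := DFunLike.congr_fun hM φ
      change f (((D : Module.End ℂ 𝓢(Fin n → ℝ, ℂ)) ^ M) (T φ)) = 0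
      rw [hDT, map_smul, h, smul_zero]
  ext φ
  exact LinearMap.congr_fun hf φ
end

section
/- Let f be a tempered distribution on 𝕂 × 𝕂 (viewed as a finite-dimensional real vector space). Suppose that: (i) for every a ∈ 𝕂ˣ and every Schwartz function φ on 𝕂 × 𝕂, f((x,y) ↦ φ(a·x, a⁻¹·y)) = f(φ); and (ii) for every Schwartz function φ, f((x,y) ↦ φ(y,x)) = −f(φ). Then f = 0. -/
open scoped ContDiff SchwartzMap

/-- The remainder of the exponential series after its first `k` terms. -/
noncomputable def expRem (k : ℕ) (z : ℂ) : ℂ :=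
  Complex.exp z - ∑ j ∈ Finset.range k, z ^ j / (j.factorial : ℂ)

theorem expRem_zero (z : ℂ) : expRem 0 z = Complex.exp z := by simp [expRem]

theorem hasDerivAt_expRem (k : ℕ) (z : ℂ) : HasDerivAt (expRem k) (expRem (k - 1) z) z := by
  have h : HasDerivAt (fun z : ℂ => ∑ j ∈ Finset.range k, z ^ j / (j.factorial : ℂ))
      (∑ j ∈ Finset.range (k - 1), z ^ j / (j.factorial : ℂ)) z := by
    cases k with
    | zero => simpa using hasDerivAt_const z (0 : ℂ)
    | succ k =>
      have h1 : ∀ j ∈ Finset.range (k + 1), HasDerivAt (fun z : ℂ => z ^ j / (j.factorial : ℂ))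
          ((j : ℂ) * z ^ (j - 1) / (j.factorial : ℂ)) z := fun j _ => (hasDerivAt_pow j z).div_const _
      have h2 := HasDerivAt.fun_sum h1
      rw [Finset.sum_range_succ'] at h2
      refine h2.congr_deriv ?_
      rw [Nat.cast_zero, zero_mul, zero_div, add_zero, Nat.add_sub_cancel]
      refine Finset.sum_congr rfl fun j _ => ?_
      rw [Nat.factorial_succ]
      push_cast
      have : (j : ℂ) + 1 ≠ 0 := by exact_mod_cast Nat.succ_ne_zero j
      have : (j.factorial : ℂ) ≠ 0 := by exact_mod_cast Nat.factorial_ne_zero j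
      field_simp
  exact (Complex.hasDerivAt_exp z).sub h

theorem norm_expRem_le (k : ℕ) {t : ℝ} (ht0 : 0 ≤ t) (ht1 : t ≤ 1) (z : ℂ) :
    ‖expRem k (t * z)‖ ≤ (t / 2) ^ k * Real.exp (2 * ‖z‖) := by
  have h1 := Complex.norm_exp_sub_sum_le_exp_norm_sub_sum (t * z) k
  refine h1.trans ?_
  have e1 := NormedSpace.expSeries_div_hasSum_exp ‖(t * z : ℂ)‖
  have e2 := NormedSpace.expSeries_div_hasSum_exp (2 * ‖z‖)
  rw [← Real.exp_eq_exp_ℝ] at e1 e2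
  have s1 := (hasSum_nat_add_iff' k).2 e1
  have s2 := ((hasSum_nat_add_iff' k).2 e2).mul_left ((t / 2) ^ k)
  refine (hasSum_le (fun j => ?_) s1 s2).trans ?_
  · rw [norm_mul, Complex.norm_real, Real.norm_of_nonneg ht0, mul_pow, mul_pow, ← mul_div_assoc]
    rw [← mul_assoc]
    gcongr
    have h3 : t ^ (j + k) ≤ t ^ k := pow_le_pow_of_le_one ht0 ht1 (by omega)
    have h4 : (1 : ℝ) ≤ 2 ^ j := one_le_pow₀ (by norm_num)
    calc t ^ (j + k) ≤ t ^ k * 1 := by simpa using h3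
      _ ≤ t ^ k * 2 ^ j := by gcongr
      _ = (t / 2) ^ k * 2 ^ (j + k) := by rw [div_pow, pow_add]; field_simp
  · gcongr
    have : 0 ≤ ∑ i ∈ Finset.range k, (2 * ‖z‖) ^ i / (i.factorial : ℝ) := by positivity
    linarith

theorem contDiff_expRem (k : ℕ) {n : WithTop ℕ∞} : ContDiff ℝ n (expRem k) := by
  unfold expRem
  fun_prop

theorem Function.HasTemperateGrowth.fderiv' {E F : Type*} [NormedAddCommGroup E] [NormedSpace ℝ E]
    [NormedAddCommGroup F] [NormedSpace ℝ F] {f : E → F} (hf : f.HasTemperateGrowth) :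
    (fderiv ℝ f).HasTemperateGrowth := by
  refine ⟨hf.1.fderiv_right (by simp), fun n => ?_⟩
  obtain ⟨k, C, h⟩ := hf.2 (n + 1)
  exact ⟨k, C, fun x => by simpa only [norm_iteratedFDeriv_fderiv] using h x⟩

section Gaussian

universe u

theorem Function.HasTemperateGrowth.exists_norm_le {E F : Type*} [NormedAddCommGroup E]
    [NormedSpace ℝ E] [NormedAddCommGroup F] [NormedSpace ℝ F] {f : E → F}
    (hf : f.HasTemperateGrowth) : ∃ (k : ℕ) (C : ℝ), ∀ x, ‖f x‖ ≤ C * (1 + ‖x‖) ^ k := by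
  obtain ⟨k, C, h⟩ := hf.2 0
  exact ⟨k, C, fun x => by simpa using h x⟩

theorem exists_norm_iteratedFDeriv_expRem_smul_le_aux {E : Type u} [NormedAddCommGroup E]
    [NormedSpace ℝ E] {q Q : E → ℂ} (hq : q.HasTemperateGrowth) (hQ : Q.HasTemperateGrowth)
    (H : ∀ m : ℕ, ∃ C : ℝ, ∀ x, ‖x‖ ^ m * Real.exp (2 * ‖q x‖ + (Q x).re) ≤ C) (n : ℕ) :
    ∀ (F : Type u) [NormedAddCommGroup F] [NormedSpace ℝ F] [NormedSpace ℂ F]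
      [IsScalarTower ℝ ℂ F] (P : E → F) (_ : P.HasTemperateGrowth) (m : ℕ),
      ∃ C : ℝ, ∀ (k : ℕ) (t : ℝ), 0 ≤ t → t ≤ 1 → ∀ x,
        ‖x‖ ^ m * ‖iteratedFDeriv ℝ n
          (fun x => (expRem k (t * q x) * Complex.exp (Q x)) • P x) x‖ ≤ C * (t / 2) ^ k := by
  induction n with
  | zero =>
    intro F _ _ _ _ P hP m
    obtain ⟨l, D, hD⟩ := hP.exists_norm_le
    obtain ⟨C₁, hC₁⟩ := H m
    obtain ⟨C₂, hC₂⟩ := H (m + l)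
    have hD0 : 0 ≤ D := by have := (norm_nonneg _).trans (hD 0); simpa using this
    refine ⟨D * (2 ^ l * (C₁ + C₂)), fun k t ht0 ht1 x => ?_⟩
    rw [norm_iteratedFDeriv_zero, norm_smul, norm_mul, Complex.norm_exp]
    have h1 := norm_expRem_le k ht0 ht1 (q x)
    have h2 := hD x
    have h3 := hC₁ x
    have h4 := hC₂ x
    have h5 : (1 + ‖x‖) ^ l ≤ 2 ^ l * (1 + ‖x‖ ^ l) := by
      have := add_pow_le (zero_le_one) (norm_nonneg x) l
      rw [one_pow] at this
      refine this.trans ?_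
      gcongr
      · norm_num
      · omega
    rw [Real.exp_add] at h3 h4
    calc ‖x‖ ^ m * (‖expRem k (t * q x)‖ * Real.exp (Q x).re * ‖P x‖)
        ≤ ‖x‖ ^ m * ((t / 2) ^ k * Real.exp (2 * ‖q x‖) * Real.exp (Q x).re *
            (D * (2 ^ l * (1 + ‖x‖ ^ l)))) := by
          gcongr
          exact h2.trans (by gcongr)
      _ = D * (2 ^ l * (‖x‖ ^ m * (Real.exp (2 * ‖q x‖) * Real.exp (Q x).re) +
            ‖x‖ ^ (m + l) * (Real.exp (2 * ‖q x‖) * Real.exp (Q x).re))) * (t / 2) ^ k := by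
          rw [pow_add]; ring
      _ ≤ _ := by gcongr
  | succ n ih =>
    intro F _ _ _ _ P hP m
    let S : F →L[ℝ] ℂ →L[ℝ] F := (ContinuousLinearMap.lsmul ℝ ℂ).flip
    let T : (E → ℂ) → E → E →L[ℝ] F :=
      fun r x => ContinuousLinearMap.compL ℝ E ℂ F (S (P x)) (fderiv ℝ r x)
    have hT : ∀ r : E → ℂ, r.HasTemperateGrowth → (T r).HasTemperateGrowth := fun r hr =>
      (ContinuousLinearMap.compL ℝ E ℂ F).bilinear_hasTemperateGrowth
        (S.hasTemperateGrowth.comp hP) hr.fderiv'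
    have hP₂ : (fun x => fderiv ℝ P x + T Q x).HasTemperateGrowth :=
      Function.HasTemperateGrowth.fun_add hP.fderiv' (hT Q hQ)
    obtain ⟨C₁, hC₁⟩ := ih (E →L[ℝ] F) (T q) (hT q hq) m
    obtain ⟨C₂, hC₂⟩ := ih (E →L[ℝ] F) _ hP₂ m
    refine ⟨2 * |C₁| + C₂, fun k t ht0 ht1 x => ?_⟩
    have hder : fderiv ℝ (fun x => (expRem k (t * q x) * Complex.exp (Q x)) • P x) =
        fun x => t • ((expRem (k - 1) (t * q x) * Complex.exp (Q x)) • T q x) +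
          (expRem k (t * q x) * Complex.exp (Q x)) • (fderiv ℝ P x + T Q x) := by
      funext x
      have dq := (hq.1.differentiable (by simp) x).hasFDerivAt
      have dQ := (hQ.1.differentiable (by simp) x).hasFDerivAt
      have dP := (hP.1.differentiable (by simp) x).hasFDerivAt
      have d1 := (hasDerivAt_expRem k (t * q x)).comp_hasFDerivAt x (dq.const_mul (t : ℂ))
      have d2 := dQ.cexp
      refine ((d1.mul d2).smul dP).fderiv.trans ?_
      ext v
      simp [T, S, smul_smul]
      module
    have cd : ∀ (j : ℕ) {G : Type u} [NormedAddCommGroup G] [NormedSpace ℝ G] [NormedSpace ℂ G]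
        [IsScalarTower ℝ ℂ G] (R : E → G) (_ : R.HasTemperateGrowth),
        ContDiff ℝ ∞ fun x => (expRem j (t * q x) * Complex.exp (Q x)) • R x := by
      intro j G _ _ _ _ R hR
      have := hq.1
      have := hQ.1
      have := hR.1
      have := (contDiff_expRem j (n := ∞))
      fun_prop
    have c1 := (cd (k - 1) _ (hT q hq)).of_le (m := n) (by exact_mod_cast le_top)
    have c2 := (cd k _ hP₂).of_le (m := n) (by exact_mod_cast le_top)
    rw [← norm_iteratedFDeriv_fderiv, hder]
    rw [fun_iteratedFDeriv_add_apply (c1.const_smul t).contDiffAt c2.contDiffAt,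
      iteratedFDeriv_const_smul_apply' c1.contDiffAt]
    have b1 := hC₁ (k - 1) t ht0 ht1 x
    have b2 := hC₂ k t ht0 ht1 x
    have b3 : t * (C₁ * (t / 2) ^ (k - 1)) ≤ 2 * |C₁| * (t / 2) ^ k := by
      cases k with
      | zero =>
        have := le_abs_self C₁
        have := abs_nonneg C₁
        simp
        nlinarith
      | succ k =>
        rw [Nat.add_sub_cancel, pow_succ]
        have : C₁ * (t / 2) ^ k ≤ |C₁| * (t / 2) ^ k := by gcongr; exact le_abs_self _
        nlinarith
    refine (mul_le_mul_of_nonneg_left (norm_add_le _ _) (by positivity)).trans ?_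
    rw [norm_smul, Real.norm_of_nonneg ht0]
    nlinarith

/-- The growth condition ensuring that `exp (t * q) * exp Q` is rapidly decreasing, uniformly in
`t ∈ [0, 1]`. -/
def GaussianBound {E : Type*} [NormedAddCommGroup E] (q Q : E → ℂ) : Prop :=
  ∀ m : ℕ, ∃ C : ℝ, ∀ x, ‖x‖ ^ m * Real.exp (2 * ‖q x‖ + (Q x).re) ≤ C

theorem GaussianBound.zero_left {E : Type*} [NormedAddCommGroup E] {q Q : E → ℂ} (H : GaussianBound q Q) :
    GaussianBound (fun _ => 0) Q := by
  intro m
  obtain ⟨C, hC⟩ := H m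
  refine ⟨C, fun x => le_trans ?_ (hC x)⟩
  gcongr
  simp

variable {E : Type*} [NormedAddCommGroup E] [NormedSpace ℝ E]

theorem exists_norm_iteratedFDeriv_expRem_mul_le {q Q P : E → ℂ} (hq : q.HasTemperateGrowth)
    (hQ : Q.HasTemperateGrowth) (hP : P.HasTemperateGrowth) (H : GaussianBound q Q) (m n : ℕ) :
    ∃ C : ℝ, ∀ (k : ℕ) (t : ℝ), 0 ≤ t → t ≤ 1 → ∀ x, ‖x‖ ^ m * ‖iteratedFDeriv ℝ n
      (fun x => expRem k (t * q x) * Complex.exp (Q x) * P x) x‖ ≤ C * (t / 2) ^ k := by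
  let e := (LinearIsometryEquiv.ulift ℝ ℂ).symm
  have : IsScalarTower ℝ ℂ (ULift ℂ) := ⟨fun a b c => by ext; simp [mul_assoc]⟩
  obtain ⟨C, hC⟩ := exists_norm_iteratedFDeriv_expRem_smul_le_aux hq hQ H n _ (fun x => e (P x))
    (e.toContinuousLinearEquiv.hasTemperateGrowth.comp hP) m
  refine ⟨C, fun k t ht0 ht1 x => ?_⟩
  have := hC k t ht0 ht1 x
  rwa [show (fun x => (expRem k (t * q x) * Complex.exp (Q x)) • e (P x)) =
    e ∘ (fun x => expRem k (t * q x) * Complex.exp (Q x) * P x) from rfl,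
    LinearIsometryEquiv.norm_iteratedFDeriv_comp_left] at this

/-- A function which is (the underlying function of) a Schwartz function. -/
def IsSchwartz (u : E → ℂ) : Prop := ∃ φ : 𝓢(E, ℂ), ⇑φ = u

theorem isSchwartz_expRem {q Q P : E → ℂ} (hq : q.HasTemperateGrowth)
    (hQ : Q.HasTemperateGrowth) (hP : P.HasTemperateGrowth) (H : GaussianBound q Q) (k : ℕ)
    {t : ℝ} (ht0 : 0 ≤ t) (ht1 : t ≤ 1) :
    IsSchwartz fun x => expRem k (t * q x) * Complex.exp (Q x) * P x := by
  refine ⟨⟨fun x => expRem k (t * q x) * Complex.exp (Q x) * P x, ?_, fun m n => ?_⟩, rfl⟩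
  · have := hq.1
    have := hQ.1
    have := hP.1
    have h1 : ContDiff ℝ ∞ fun x => expRem k (t * q x) := by
      have := (contDiff_expRem k (n := ∞))
      fun_prop
    fun_prop
  · obtain ⟨C, hC⟩ := exists_norm_iteratedFDeriv_expRem_mul_le hq hQ hP H m n
    exact ⟨_, hC k t ht0 ht1⟩

theorem isSchwartz_exp_mul {Q P : E → ℂ} (hQ : Q.HasTemperateGrowth) (hP : P.HasTemperateGrowth)
    (H : GaussianBound (fun _ => 0) Q) : IsSchwartz fun x => Complex.exp (Q x) * P x := by
  simpa [expRem_zero] using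
    isSchwartz_expRem (.const 0) hQ hP H 0 zero_le_one le_rfl

open Classical in
/-- The value of a tempered distribution at a function, with value `0` if the function is not a
Schwartz function. -/
noncomputable def evalAt (f : 𝓢(E, ℂ) →L[ℂ] ℂ) (u : E → ℂ) : ℂ :=
  if h : IsSchwartz u then f h.choose else 0

variable (f : 𝓢(E, ℂ) →L[ℂ] ℂ)

theorem evalAt_coe (φ : 𝓢(E, ℂ)) : evalAt f φ = f φ := by
  have h : IsSchwartz (φ : E → ℂ) := ⟨φ, rfl⟩
  rw [evalAt, dif_pos h]
  congr 1
  exact DFunLike.coe_injective h.choose_spec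

theorem evalAt_add {u v : E → ℂ} (hu : IsSchwartz u) (hv : IsSchwartz v) :
    evalAt f (fun x => u x + v x) = evalAt f u + evalAt f v := by
  obtain ⟨φ, rfl⟩ := hu
  obtain ⟨ψ, rfl⟩ := hv
  rw [evalAt_coe, evalAt_coe, ← map_add, ← evalAt_coe]
  rfl

theorem evalAt_const_mul {u : E → ℂ} (hu : IsSchwartz u) (c : ℂ) :
    evalAt f (fun x => c * u x) = c * evalAt f u := by
  obtain ⟨φ, rfl⟩ := hu
  rw [evalAt_coe, ← smul_eq_mul, ← map_smul, ← evalAt_coe]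
  rfl

theorem IsSchwartz.const_mul {u : E → ℂ} (hu : IsSchwartz u) (c : ℂ) :
    IsSchwartz fun x => c * u x := by
  obtain ⟨φ, rfl⟩ := hu
  exact ⟨c • φ, rfl⟩

theorem IsSchwartz.add {u v : E → ℂ} (hu : IsSchwartz u) (hv : IsSchwartz v) :
    IsSchwartz fun x => u x + v x := by
  obtain ⟨φ, rfl⟩ := hu
  obtain ⟨ψ, rfl⟩ := hv
  exact ⟨φ + ψ, rfl⟩

theorem IsSchwartz.sum {ι : Type*} {s : Finset ι} {u : ι → E → ℂ}
    (hu : ∀ i ∈ s, IsSchwartz (u i)) : IsSchwartz fun x => ∑ i ∈ s, u i x := by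
  classical
  induction s using Finset.induction_on with
  | empty => exact ⟨0, by ext; simp⟩
  | insert a s ha ih =>
    simp only [Finset.sum_insert ha]
    exact (hu a (by simp)).add (ih fun i hi => hu i (by simp [hi]))

theorem evalAt_sum {ι : Type*} {s : Finset ι} {u : ι → E → ℂ}
    (hu : ∀ i ∈ s, IsSchwartz (u i)) :
    evalAt f (fun x => ∑ i ∈ s, u i x) = ∑ i ∈ s, evalAt f (u i) := by
  classical
  induction s using Finset.induction_on with
  | empty =>
    simp only [Finset.sum_empty]
    exact (evalAt_coe f 0).trans (map_zero f)
  | insert a s ha ih =>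
    simp only [Finset.sum_insert ha]
    rw [evalAt_add f (hu a (by simp)) (IsSchwartz.sum fun i hi => hu i (by simp [hi])),
      ih fun i hi => hu i (by simp [hi])]

theorem exists_norm_le_of_seminorm_le : ∃ (N : ℕ) (C : ℝ), 0 ≤ C ∧ ∀ (φ : 𝓢(E, ℂ)) (A : ℝ), 0 ≤ A →
    (∀ m ≤ N, ∀ n ≤ N, ∀ x, ‖x‖ ^ m * ‖iteratedFDeriv ℝ n φ x‖ ≤ A) → ‖f φ‖ ≤ C * A := by
  obtain ⟨s, C, -, hC⟩ := Seminorm.bound_of_continuous (schwartz_withSeminorms ℂ E ℂ)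
    ((normSeminorm ℂ ℂ).comp (f : 𝓢(E, ℂ) →ₗ[ℂ] ℂ)) (continuous_norm.comp f.continuous)
  refine ⟨s.sup fun i => max i.1 i.2, C, C.2, fun φ A hA h => ?_⟩
  refine (hC φ).trans ?_
  rw [smul_apply, NNReal.smul_def, smul_eq_mul]
  gcongr
  refine Seminorm.finset_sup_apply_le hA fun i hi => ?_
  have hi' := Finset.le_sup (f := fun i : ℕ × ℕ => max i.1 i.2) hi
  exact SchwartzMap.seminorm_le_bound ℂ _ _ φ hA fun x =>
    h _ ((le_max_left _ _).trans hi') _ ((le_max_right _ _).trans hi') x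

theorem exists_norm_evalAt_expRem_le {q Q P : E → ℂ} (hq : q.HasTemperateGrowth)
    (hQ : Q.HasTemperateGrowth) (hP : P.HasTemperateGrowth) (H : GaussianBound q Q) :
    ∃ C : ℝ, 0 ≤ C ∧ ∀ (k : ℕ) (t : ℝ), 0 ≤ t → t ≤ 1 →
      ‖evalAt f (fun x => expRem k (t * q x) * Complex.exp (Q x) * P x)‖ ≤ C * (t / 2) ^ k := by
  obtain ⟨N, C, hC0, hC⟩ := exists_norm_le_of_seminorm_le f
  choose D hD using exists_norm_iteratedFDeriv_expRem_mul_le hq hQ hP H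
  let A := ∑ m ∈ Finset.range (N + 1), ∑ n ∈ Finset.range (N + 1), |D m n|
  have hA : ∀ m ≤ N, ∀ n ≤ N, D m n ≤ A := fun m hm n hn => by
    refine (le_abs_self _).trans ?_
    refine (Finset.single_le_sum (f := fun n => |D m n|) (fun _ _ => abs_nonneg _)
      (Finset.mem_range_succ_iff.2 hn)).trans ?_
    exact Finset.single_le_sum (f := fun m => ∑ n ∈ Finset.range (N + 1), |D m n|)
      (fun _ _ => Finset.sum_nonneg fun _ _ => abs_nonneg _) (Finset.mem_range_succ_iff.2 hm)
  have hA0 : 0 ≤ A := Finset.sum_nonneg fun _ _ => Finset.sum_nonneg fun _ _ => abs_nonneg _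
  refine ⟨C * A, by positivity, fun k t ht0 ht1 => ?_⟩
  obtain ⟨φ, hφ⟩ := isSchwartz_expRem hq hQ hP H k ht0 ht1
  rw [← hφ, evalAt_coe, mul_assoc]
  refine hC φ _ (by positivity) fun m hm n hn x => ?_
  rw [hφ]
  refine (hD m n k t ht0 ht1 x).trans ?_
  gcongr
  exact hA m hm n hn

theorem evalAt_expRem {q Q P : E → ℂ} (hq : q.HasTemperateGrowth)
    (hQ : Q.HasTemperateGrowth) (hP : P.HasTemperateGrowth) (H : GaussianBound q Q) (k : ℕ)
    {t : ℝ} (ht0 : 0 ≤ t) (ht1 : t ≤ 1) :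
    evalAt f (fun x => expRem k (t * q x) * Complex.exp (Q x) * P x) =
      evalAt f (fun x => Complex.exp (t * q x) * Complex.exp (Q x) * P x) -
        ∑ j ∈ Finset.range k, (t : ℂ) ^ j / (j.factorial : ℂ) *
          evalAt f (fun x => Complex.exp (Q x) * (q x ^ j * P x)) := by
  have h1 : ∀ j, IsSchwartz fun x => Complex.exp (Q x) * (q x ^ j * P x) := fun j =>
    isSchwartz_exp_mul hQ (by fun_prop) H.zero_left
  have h2 := isSchwartz_expRem hq hQ hP H k ht0 ht1
  rw [eq_sub_iff_add_eq]
  simp_rw [← fun j => evalAt_const_mul f (h1 j)]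
  rw [← evalAt_sum f (fun j _ => (h1 j).const_mul _), ← evalAt_add f h2
    (IsSchwartz.sum fun j _ => (h1 j).const_mul _)]
  congr 1
  funext x
  have : ∑ j ∈ Finset.range k, (t : ℂ) ^ j / (j.factorial : ℂ) * (Complex.exp (Q x) * (q x ^ j * P x)) =
      (∑ j ∈ Finset.range k, (t * q x) ^ j / (j.factorial : ℂ)) * Complex.exp (Q x) * P x := by
    rw [Finset.sum_mul, Finset.sum_mul]
    exact Finset.sum_congr rfl fun j _ => by ring
  rw [this, expRem]
  ring

theorem evalAt_exp_mul_exp_eq_zero {q Q P : E → ℂ} (hq : q.HasTemperateGrowth)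
    (hQ : Q.HasTemperateGrowth) (hP : P.HasTemperateGrowth) (H : GaussianBound q Q)
    (h : ∀ j : ℕ, evalAt f (fun x => Complex.exp (Q x) * (q x ^ j * P x)) = 0) :
    evalAt f (fun x => Complex.exp (q x) * Complex.exp (Q x) * P x) = 0 := by
  obtain ⟨C, hC0, hC⟩ := exists_norm_evalAt_expRem_le f hq hQ hP H
  have h1 : ∀ k : ℕ, ‖evalAt f (fun x => Complex.exp (q x) * Complex.exp (Q x) * P x)‖ ≤
      C * (1 / 2) ^ k := fun k => by
    have := hC k 1 zero_le_one le_rfl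
    rw [evalAt_expRem f hq hQ hP H k zero_le_one le_rfl] at this
    simpa [h] using this
  have h2 : Filter.Tendsto (fun k : ℕ => C * (1 / 2 : ℝ) ^ k) Filter.atTop (nhds (C * 0)) :=
    (tendsto_pow_atTop_nhds_zero_of_lt_one (by norm_num) (by norm_num)).const_mul C
  rw [mul_zero] at h2
  exact norm_le_zero_iff.1 (ge_of_tendsto' h2 h1)

theorem evalAt_mul_eq_of_exp_eq {q Q P q' Q' P' : E → ℂ} (hq : q.HasTemperateGrowth)
    (hQ : Q.HasTemperateGrowth) (hP : P.HasTemperateGrowth) (H : GaussianBound q Q)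
    (hq' : q'.HasTemperateGrowth) (hQ' : Q'.HasTemperateGrowth) (hP' : P'.HasTemperateGrowth)
    (H' : GaussianBound q' Q')
    (h : ∀ t : ℝ, 0 ≤ t → t ≤ 1 →
      evalAt f (fun x => Complex.exp (t * q x) * Complex.exp (Q x) * P x) =
        evalAt f (fun x => Complex.exp (t * q' x) * Complex.exp (Q' x) * P' x)) :
    evalAt f (fun x => Complex.exp (Q x) * (q x * P x)) =
      evalAt f (fun x => Complex.exp (Q' x) * (q' x * P' x)) := by
  obtain ⟨C, hC0, hC⟩ := exists_norm_evalAt_expRem_le f hq hQ hP H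
  obtain ⟨C', hC0', hC'⟩ := exists_norm_evalAt_expRem_le f hq' hQ' hP' H'
  have h0 := h 0 le_rfl zero_le_one
  simp only [Complex.ofReal_zero, zero_mul, Complex.exp_zero, one_mul] at h0
  set B := evalAt f (fun x => Complex.exp (Q x) * (q x * P x)) with hB
  set B' := evalAt f (fun x => Complex.exp (Q' x) * (q' x * P' x)) with hB'
  have h1 : ∀ t : ℝ, 0 < t → t ≤ 1 → ‖B - B'‖ ≤ (C + C') * t := fun t ht0 ht1 => by
    have e1 := hC 2 t ht0.le ht1
    have e2 := hC' 2 t ht0.le ht1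
    rw [evalAt_expRem f hq hQ hP H 2 ht0.le ht1] at e1
    rw [evalAt_expRem f hq' hQ' hP' H' 2 ht0.le ht1, ← h t ht0.le ht1] at e2
    simp only [Finset.sum_range_succ, Finset.range_zero, Finset.sum_empty, pow_zero, pow_one,
      Nat.factorial_zero, Nat.factorial_one, Nat.cast_one, div_one, one_mul, zero_add] at e1 e2
    rw [← hB, h0] at e1
    rw [← hB'] at e2
    have e3 := norm_sub_le_of_le e2 e1
    rw [sub_sub_sub_cancel_left, add_sub_add_left_eq_sub, ← mul_sub, norm_mul, Complex.norm_real,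
      Real.norm_of_nonneg ht0.le] at e3
    have : 0 ≤ C * t ^ 2 := by positivity
    have : 0 ≤ C' * t ^ 2 := by positivity
    refine le_of_mul_le_mul_left ?_ ht0
    nlinarith
  have h2 : Filter.Tendsto (fun t : ℝ => (C + C') * t) (nhdsWithin 0 (Set.Ioi 0))
      (nhds ((C + C') * 0)) :=
    ((continuous_const.mul continuous_id).tendsto 0).mono_left nhdsWithin_le_nhds
  rw [mul_zero] at h2
  refine sub_eq_zero.1 (norm_le_zero_iff.1 (ge_of_tendsto h2 ?_))
  filter_upwards [Ioc_mem_nhdsGT (zero_lt_one' ℝ)] with t ht using h1 t ht.1 ht.2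

end Gaussian

section Convolution

open MeasureTheory FourierTransform LineDeriv
open scoped BoundedContinuousFunction

namespace SchwartzMap

section Weighted

variable {E : Type*} [NormedAddCommGroup E] [NormedSpace ℝ E]

theorem exists_one_add_pow_mul_norm_iteratedFDeriv_le (φ : 𝓢(E, ℂ)) (N n : ℕ) :
    ∃ C : ℝ, ∀ x, (1 + ‖x‖) ^ N * ‖iteratedFDeriv ℝ n φ x‖ ≤ C :=
  ⟨_, fun x => one_add_le_sup_seminorm_apply (𝕜 := ℝ) (m := (N, n)) le_rfl le_rfl φ x⟩

/-- The `n`-th derivative of a Schwartz function, multiplied by the weight `(1 + ‖x‖) ^ N`, as a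
bounded continuous function. -/
noncomputable def weightedDeriv (N n : ℕ) (φ : 𝓢(E, ℂ)) : E →ᵇ E [×n]→L[ℝ] ℂ :=
  BoundedContinuousFunction.ofNormedAddCommGroup
    (fun x => (1 + ‖x‖) ^ N • iteratedFDeriv ℝ n φ x)
    (((continuous_const.add continuous_norm).pow N).smul
      ((φ.smooth n).continuous_iteratedFDeriv le_rfl))
    (exists_one_add_pow_mul_norm_iteratedFDeriv_le φ N n).choose
    (fun x => by
      rw [norm_smul, Real.norm_of_nonneg (by positivity)]
      exact (exists_one_add_pow_mul_norm_iteratedFDeriv_le φ N n).choose_spec x)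

theorem weightedDeriv_apply (N n : ℕ) (φ : 𝓢(E, ℂ)) (x : E) :
    weightedDeriv N n φ x = (1 + ‖x‖) ^ N • iteratedFDeriv ℝ n φ x := rfl

/-- The space of families of bounded continuous functions containing all weighted derivatives
of order at most `N` of Schwartz functions. -/
def WeightedSpace (E : Type*) [NormedAddCommGroup E] [NormedSpace ℝ E] (N : ℕ) : Type _ :=
  ∀ n : Fin (N + 1), E →ᵇ E [×(n : ℕ)]→L[ℝ] ℂ

noncomputable instance (N : ℕ) : NormedAddCommGroup (WeightedSpace E N) :=
  Pi.normedAddCommGroup (G := fun n : Fin (N + 1) => E →ᵇ E [×(n : ℕ)]→L[ℝ] ℂ)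

noncomputable instance (N : ℕ) : NormedSpace ℂ (WeightedSpace E N) :=
  Pi.normedSpace (E := fun n : Fin (N + 1) => E →ᵇ E [×(n : ℕ)]→L[ℝ] ℂ)

instance (N : ℕ) : CompleteSpace (WeightedSpace E N) :=
  Pi.complete (fun n : Fin (N + 1) => E →ᵇ E [×(n : ℕ)]→L[ℝ] ℂ)

/-- The component of order `n` of an element of the weighted space, as a continuous linear map. -/
noncomputable def WeightedSpace.proj (N : ℕ) (n : Fin (N + 1)) :
    WeightedSpace E N →L[ℂ] E →ᵇ E [×(n : ℕ)]→L[ℝ] ℂ :=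
  ContinuousLinearMap.proj (φ := fun n : Fin (N + 1) => E →ᵇ E [×(n : ℕ)]→L[ℝ] ℂ) n

theorem WeightedSpace.norm_le_iff {N : ℕ} {b : WeightedSpace E N} {C : ℝ} (hC : 0 ≤ C) :
    ‖b‖ ≤ C ↔ ∀ n x, ‖b n x‖ ≤ C :=
  (pi_norm_le_iff_of_nonneg (G := fun n : Fin (N + 1) => E →ᵇ E [×(n : ℕ)]→L[ℝ] ℂ) hC).trans
    (forall_congr' fun _ => BoundedContinuousFunction.norm_le hC)

/-- All weighted derivatives up to order `N` of a Schwartz function. -/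
noncomputable def weightedDerivs (N : ℕ) :
    𝓢(E, ℂ) →ₗ[ℂ] WeightedSpace E N where
  toFun φ n := weightedDeriv N n φ
  map_add' φ ψ := by
    funext n
    change weightedDeriv N n (φ + ψ) = weightedDeriv N n φ + weightedDeriv N n ψ
    ext x v
    have h := iteratedFDeriv_add_apply (i := n) (x := x) (φ.smooth n).contDiffAt
      (ψ.smooth n).contDiffAt
    simp [weightedDeriv_apply, h]
  map_smul' c φ := by
    funext n
    change weightedDeriv N n (c • φ) = c • weightedDeriv N n φ
    ext x v
    have h := iteratedFDeriv_const_smul_apply (i := n) (x := x) (a := c) (φ.smooth n).contDiffAt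
    simp [weightedDeriv_apply, h, mul_left_comm]

theorem weightedDerivs_apply (N : ℕ) (φ : 𝓢(E, ℂ)) (n : Fin (N + 1)) (x : E) :
    weightedDerivs N φ n x = (1 + ‖x‖) ^ N • iteratedFDeriv ℝ n φ x := rfl

theorem weightedDerivs_injective (N : ℕ) :
    Function.Injective (weightedDerivs N : 𝓢(E, ℂ) →ₗ[ℂ] _) := by
  rw [injective_iff_map_eq_zero]
  intro φ h
  ext x
  have h1 : ((1 + ‖x‖) ^ N • iteratedFDeriv ℝ 0 φ x) ![] = 0 := congrArg (fun b => b 0 x ![]) h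
  have h2 : (1 + ‖x‖) ^ N ≠ 0 := by positivity
  rw [smul_apply, iteratedFDeriv_zero_apply] at h1
  exact (smul_eq_zero.1 h1).resolve_left h2

/-- A tempered distribution factors through finitely many weighted derivatives. -/
theorem exists_continuousLinearMap_weightedDerivs (f : 𝓢(E, ℂ) →L[ℂ] ℂ) :
    ∃ (N : ℕ) (L : WeightedSpace E N →L[ℂ] ℂ),
      ∀ φ, L (weightedDerivs N φ) = f φ := by
  obtain ⟨N, C, hC0, hC⟩ := exists_norm_le_of_seminorm_le f
  let e := LinearEquiv.ofInjective _ (weightedDerivs_injective (E := E) N)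
  have hb : ∀ b, ‖((f : 𝓢(E, ℂ) →ₗ[ℂ] ℂ) ∘ₗ e.symm.toLinearMap) b‖ ≤ C * ‖b‖ := by
    intro b
    obtain ⟨φ, rfl⟩ := e.surjective b
    simp only [LinearMap.comp_apply, LinearEquiv.coe_coe, LinearEquiv.symm_apply_apply,
      ContinuousLinearMap.coe_coe]
    refine hC φ _ (norm_nonneg _) fun m hm n hn x => ?_
    have h1 : ‖weightedDerivs N φ ⟨n, Nat.lt_succ_of_le hn⟩ x‖ ≤ ‖weightedDerivs N φ‖ :=
      (WeightedSpace.norm_le_iff (norm_nonneg _)).1 le_rfl _ x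
    rw [weightedDerivs_apply, norm_smul, Real.norm_of_nonneg (by positivity)] at h1
    refine le_trans ?_ h1
    gcongr
    calc ‖x‖ ^ m ≤ (1 + ‖x‖) ^ m := by gcongr; linarith
      _ ≤ (1 + ‖x‖) ^ N := pow_le_pow_right₀ (by linarith [norm_nonneg x]) hm
  obtain ⟨L, hL, -⟩ := exists_extension_norm_eq _ (LinearMap.mkContinuous _ C hb)
  refine ⟨N, L, fun φ => ?_⟩
  have := hL (e φ)
  simpa [e] using this

theorem iteratedFDeriv_compSubConstCLM (φ : 𝓢(E, ℂ)) (n : ℕ) (y x : E) :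
    iteratedFDeriv ℝ n (compSubConstCLM ℂ y φ) x = iteratedFDeriv ℝ n φ (x - y) :=
  iteratedFDeriv_comp_sub n y x

theorem one_add_norm_pow_le_mul {E : Type*} [NormedAddCommGroup E] (x y : E) (N : ℕ) :
    (1 + ‖x‖) ^ N ≤ (1 + ‖y‖) ^ N * (1 + ‖x - y‖) ^ N := by
  rw [← mul_pow]
  gcongr
  have := norm_sub_norm_le x y
  nlinarith [norm_nonneg y, norm_nonneg (x - y)]

theorem exists_norm_weightedDerivs_compSubConstCLM_le (N : ℕ) (φ : 𝓢(E, ℂ)) :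
    ∃ C : ℝ, ∀ y, ‖weightedDerivs N (compSubConstCLM ℂ y φ)‖ ≤ C * (1 + ‖y‖) ^ N := by
  choose C hC using exists_one_add_pow_mul_norm_iteratedFDeriv_le φ N
  have hC0 : ∀ n, 0 ≤ C n := fun n => le_trans (by positivity) (hC n 0)
  have hCs : 0 ≤ ∑ i ∈ Finset.range (N + 1), C i := Finset.sum_nonneg fun i _ => hC0 i
  refine ⟨∑ n ∈ Finset.range (N + 1), C n, fun y => ?_⟩
  refine (WeightedSpace.norm_le_iff (by positivity)).2 fun n x => ?_
  rw [weightedDerivs_apply, norm_smul, Real.norm_of_nonneg (by positivity),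
    iteratedFDeriv_compSubConstCLM]
  have h1 := hC n (x - y)
  have h2 : C n ≤ ∑ n ∈ Finset.range (N + 1), C n :=
    Finset.single_le_sum (f := C) (fun i _ => hC0 i) (Finset.mem_range.2 n.2)
  calc (1 + ‖x‖) ^ N * ‖iteratedFDeriv ℝ n φ (x - y)‖
      ≤ (1 + ‖y‖) ^ N * (1 + ‖x - y‖) ^ N * ‖iteratedFDeriv ℝ n φ (x - y)‖ := by
        gcongr; exact one_add_norm_pow_le_mul x y N
    _ = (1 + ‖y‖) ^ N * ((1 + ‖x - y‖) ^ N * ‖iteratedFDeriv ℝ n φ (x - y)‖) := by ring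
    _ ≤ (1 + ‖y‖) ^ N * ∑ n ∈ Finset.range (N + 1), C n := by gcongr; exact h1.trans h2
    _ = _ := mul_comm _ _

theorem continuous_weightedDerivs_compSubConstCLM (N : ℕ) (φ : 𝓢(E, ℂ)) :
    Continuous fun y => weightedDerivs N (compSubConstCLM ℂ y φ) := by
  refine continuous_pi (A := fun n : Fin (N + 1) => E →ᵇ E [×(n : ℕ)]→L[ℝ] ℂ) fun n => ?_
  obtain ⟨C, hC⟩ := exists_one_add_pow_mul_norm_iteratedFDeriv_le φ N (n + 1)
  have hC0 : 0 ≤ C := le_trans (by positivity) (hC 0)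
  have key : ∀ y y' : E, dist (weightedDerivs N (compSubConstCLM ℂ y' φ) n)
      (weightedDerivs N (compSubConstCLM ℂ y φ) n) ≤
      (2 + ‖y‖ + ‖y' - y‖) ^ N * C * ‖y' - y‖ := by
    intro y y'
    refine (BoundedContinuousFunction.dist_le (by positivity)).2 fun x => ?_
    rw [weightedDerivs_apply, weightedDerivs_apply]
    refine (dist_smul₀ ((1 + ‖x‖) ^ N) (iteratedFDeriv ℝ n (compSubConstCLM ℂ y' φ) x)
      (iteratedFDeriv ℝ n (compSubConstCLM ℂ y φ) x)).trans_le ?_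
    rw [dist_eq_norm, Real.norm_of_nonneg (by positivity), iteratedFDeriv_compSubConstCLM,
      iteratedFDeriv_compSubConstCLM]
    have hmv := (convex_segment (x - y) (x - y')).norm_image_sub_le_of_norm_fderiv_le
      (𝕜 := ℝ) (f := iteratedFDeriv ℝ n φ) (x := x - y) (y := x - y')
      (C := ((1 + ‖x‖) ^ N)⁻¹ * ((2 + ‖y‖ + ‖y' - y‖) ^ N * C))
      (fun z _ => ((φ.smooth ⊤).differentiable_iteratedFDeriv
        (by exact_mod_cast WithTop.coe_lt_top _) z))
      (fun z hz => ?_) (left_mem_segment _ _ _) (right_mem_segment _ _ _)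
    · rw [sub_sub_sub_cancel_left, ← norm_neg (y - y'), neg_sub] at hmv
      calc (1 + ‖x‖) ^ N * ‖iteratedFDeriv ℝ n φ (x - y') - iteratedFDeriv ℝ n φ (x - y)‖
          ≤ (1 + ‖x‖) ^ N * (((1 + ‖x‖) ^ N)⁻¹ * ((2 + ‖y‖ + ‖y' - y‖) ^ N * C) * ‖y' - y‖) := by
            gcongr
        _ = _ := by field_simp
    · rw [norm_fderiv_iteratedFDeriv, le_inv_mul_iff₀ (by positivity)]
      have hz' : ‖x - z‖ ≤ 1 + ‖y‖ + ‖y' - y‖ := by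
        have h1 : dist (x - y) z ≤ dist (x - y) (x - y') := by
          have := dist_add_dist_of_mem_segment hz
          linarith [dist_nonneg (x := z) (y := x - y')]
        rw [dist_eq_norm, dist_eq_norm, sub_sub_sub_cancel_left] at h1
        have h2 : x - z = (x - y - z) + y := by abel
        have h3 := norm_add_le (x - y - z) y
        rw [h2]
        linarith
      calc (1 + ‖x‖) ^ N * ‖iteratedFDeriv ℝ (n + 1) φ z‖
          ≤ (1 + ‖x - z‖) ^ N * (1 + ‖x - (x - z)‖) ^ N * ‖iteratedFDeriv ℝ (n + 1) φ z‖ := by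
            gcongr; exact one_add_norm_pow_le_mul x (x - z) N
        _ = (1 + ‖x - z‖) ^ N * ((1 + ‖z‖) ^ N * ‖iteratedFDeriv ℝ (n + 1) φ z‖) := by
            rw [sub_sub_cancel]; ring
        _ ≤ (2 + ‖y‖ + ‖y' - y‖) ^ N * C := by
            have h5 : (1 + ‖x - z‖) ^ N ≤ (2 + ‖y‖ + ‖y' - y‖) ^ N :=
              pow_le_pow_left₀ (by positivity) (by linarith) N
            exact mul_le_mul h5 (hC z) (by positivity) (by positivity)
  rw [continuous_iff_continuousAt]
  intro y
  refine tendsto_iff_dist_tendsto_zero.2 (squeeze_zero (fun _ => dist_nonneg) (key y) ?_)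
  have : Continuous fun y' => (2 + ‖y‖ + ‖y' - y‖) ^ N * C * ‖y' - y‖ := by fun_prop
  simpa using this.tendsto y

theorem continuous_apply_compSubConstCLM (f : 𝓢(E, ℂ) →L[ℂ] ℂ) (φ : 𝓢(E, ℂ)) :
    Continuous fun y => f (compSubConstCLM ℂ y φ) := by
  obtain ⟨N, L, hL⟩ := exists_continuousLinearMap_weightedDerivs f
  simp_rw [← hL]
  exact L.continuous.comp (continuous_weightedDerivs_compSubConstCLM N φ)

end Weighted

section Convolution

variable {V : Type*} [NormedAddCommGroup V] [InnerProductSpace ℝ V] [FiniteDimensional ℝ V]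
  [MeasurableSpace V] [BorelSpace V]

theorem convolution_mul_apply (ψ φ : 𝓢(V, ℂ)) (x : V) :
    convolution (ContinuousLinearMap.mul ℂ ℂ) ψ φ x = ∫ y, ψ y * φ (x - y) := by
  rw [convolution_apply]
  rfl

theorem convolution_mul_comm (ψ φ : 𝓢(V, ℂ)) :
    convolution (ContinuousLinearMap.mul ℂ ℂ) ψ φ =
      convolution (ContinuousLinearMap.mul ℂ ℂ) φ ψ := by
  rw [← convolution_flip]
  congr 2
  ext
  simp

theorem lineDerivOp_convolution_mul (ψ φ : 𝓢(V, ℂ)) (m : V) :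
    ∂_{m} (convolution (ContinuousLinearMap.mul ℂ ℂ) ψ φ) =
      convolution (ContinuousLinearMap.mul ℂ ℂ) ψ (∂_{m} φ) := by
  have h : 𝓕 (∂_{m} (convolution (ContinuousLinearMap.mul ℂ ℂ) ψ φ)) =
      𝓕 (convolution (ContinuousLinearMap.mul ℂ ℂ) ψ (∂_{m} φ)) := by
    have hm : (inner ℝ · m : V → ℝ).HasTemperateGrowth := by fun_prop
    rw [fourier_lineDerivOp_eq, fourier_convolution, fourier_convolution, fourier_lineDerivOp_eq]
    ext x
    simp [smulLeftCLM_apply_apply hm, pairing_apply_apply]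
    ring
  simpa using congrArg 𝓕⁻ h

theorem iteratedLineDerivOp_convolution_mul (ψ φ : 𝓢(V, ℂ)) {n : ℕ} (m : Fin n → V) :
    ∂^{m} (convolution (ContinuousLinearMap.mul ℂ ℂ) ψ φ) =
      convolution (ContinuousLinearMap.mul ℂ ℂ) ψ (∂^{m} φ) := by
  induction n with
  | zero => simp
  | succ n ih => rw [iteratedLineDerivOp_succ_left, ih, lineDerivOp_convolution_mul,
      ← iteratedLineDerivOp_succ_left]

theorem integrable_one_add_norm_pow_mul_norm (ψ : 𝓢(V, ℂ)) (N : ℕ) :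
    Integrable fun y => (1 + ‖y‖) ^ N * ‖ψ y‖ := by
  simp_rw [add_comm (1 : ℝ), add_pow, one_pow, mul_one, Finset.sum_mul]
  refine integrable_finsetSum _ fun i _ => ?_
  have := (ψ.integrable_pow_mul volume i).const_mul (N.choose i : ℝ)
  refine this.congr (.of_forall fun y => ?_)
  simp only
  ring

theorem integrable_smul_weightedDerivs (N : ℕ) (ψ φ : 𝓢(V, ℂ)) :
    Integrable fun y => ψ y • weightedDerivs N (compSubConstCLM ℂ y φ) := by
  obtain ⟨C, hC⟩ := exists_norm_weightedDerivs_compSubConstCLM_le N φ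
  refine ((integrable_one_add_norm_pow_mul_norm ψ N).const_mul C).mono'
    (ψ.continuous.smul (continuous_weightedDerivs_compSubConstCLM N φ)).aestronglyMeasurable
    (.of_forall fun y => ?_)
  rw [norm_smul]
  calc ‖ψ y‖ * ‖weightedDerivs N (compSubConstCLM ℂ y φ)‖ ≤ ‖ψ y‖ * (C * (1 + ‖y‖) ^ N) := by
        gcongr; exact hC y
    _ = _ := by ring

theorem weightedDerivs_convolution_mul (N : ℕ) (ψ φ : 𝓢(V, ℂ)) :
    weightedDerivs N (convolution (ContinuousLinearMap.mul ℂ ℂ) ψ φ) =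
      ∫ y, ψ y • weightedDerivs N (compSubConstCLM ℂ y φ) := by
  funext n
  ext x v
  have hi := integrable_smul_weightedDerivs N ψ φ
  let ev : WeightedSpace V N →L[ℝ] ℂ :=
    (ContinuousMultilinearMap.apply ℝ (fun _ : Fin n => V) ℂ v) ∘L
      (BoundedContinuousFunction.evalCLM ℝ x) ∘L (WeightedSpace.proj N n).restrictScalars ℝ
  have h1 : ∀ b, ev b = b n x v := fun b => rfl
  rw [← h1, ← h1, ← ContinuousLinearMap.integral_comp_comm ev hi]
  simp_rw [h1]
  have h2 : ∀ y, (ψ y • weightedDerivs N (compSubConstCLM ℂ y φ)) n x v =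
      (1 + ‖x‖) ^ N * (ψ y * (∂^{v} φ) (x - y)) := fun y => by
    have : (ψ y • weightedDerivs N (compSubConstCLM ℂ y φ)) n x v =
      ψ y * ((1 + ‖x‖) ^ N • iteratedFDeriv ℝ n (compSubConstCLM ℂ y φ) x v) := rfl
    rw [this, iteratedFDeriv_compSubConstCLM, iteratedLineDerivOp_eq_iteratedFDeriv,
      Complex.real_smul]
    push_cast
    ring
  simp_rw [h2]
  rw [integral_const_mul, ← convolution_mul_apply, ← iteratedLineDerivOp_convolution_mul,
    iteratedLineDerivOp_eq_iteratedFDeriv, weightedDerivs_apply, smul_apply, Complex.real_smul]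
  push_cast
  rfl

theorem apply_convolution_mul (f : 𝓢(V, ℂ) →L[ℂ] ℂ) (ψ φ : 𝓢(V, ℂ)) :
    f (convolution (ContinuousLinearMap.mul ℂ ℂ) ψ φ) =
      ∫ y, ψ y * f (compSubConstCLM ℂ y φ) := by
  obtain ⟨N, L, hL⟩ := exists_continuousLinearMap_weightedDerivs f
  rw [← hL, weightedDerivs_convolution_mul,
    ← ContinuousLinearMap.integral_comp_comm L (integrable_smul_weightedDerivs N ψ φ)]
  simp [hL]

theorem integrable_mul_apply_compSubConstCLM (f : 𝓢(V, ℂ) →L[ℂ] ℂ) (ψ φ : 𝓢(V, ℂ)) :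
    Integrable fun y => ψ y * f (compSubConstCLM ℂ y φ) := by
  obtain ⟨N, L, hL⟩ := exists_continuousLinearMap_weightedDerivs f
  simpa [hL] using L.integrable_comp (integrable_smul_weightedDerivs N ψ φ)

end Convolution

end SchwartzMap

end Convolution

section Density

open MeasureTheory
open scoped RealInnerProductSpace

theorem pow_mul_exp_neg_mul_sq_le (m : ℕ) {c : ℝ} (hc : 0 < c) {s : ℝ} (hs : 0 ≤ s) :
    s ^ m * Real.exp (-(c * s ^ 2)) ≤ m.factorial * Real.exp (1 / (4 * c)) := by
  have h1 := Real.pow_div_factorial_le_exp s hs m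
  rw [div_le_iff₀' (by positivity)] at h1
  have h2 : s + -(c * s ^ 2) ≤ 1 / (4 * c) := by
    rw [le_div_iff₀ (by positivity)]
    nlinarith [sq_nonneg (2 * c * s - 1)]
  calc s ^ m * Real.exp (-(c * s ^ 2)) ≤ m.factorial * Real.exp s * Real.exp (-(c * s ^ 2)) := by
        gcongr
    _ = m.factorial * Real.exp (s + -(c * s ^ 2)) := by rw [Real.exp_add, mul_assoc]
    _ ≤ _ := by gcongr

theorem GaussianBound.of_le {E : Type*} [NormedAddCommGroup E] {q Q : E → ℂ} (K : ℝ) {c : ℝ}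
    (hc : 0 < c) (h : ∀ x, 2 * ‖q x‖ + (Q x).re ≤ K - c * ‖x‖ ^ 2) : GaussianBound q Q := by
  refine fun m => ⟨Real.exp K * (m.factorial * Real.exp (1 / (4 * c))), fun x => ?_⟩
  calc ‖x‖ ^ m * Real.exp (2 * ‖q x‖ + (Q x).re)
      ≤ ‖x‖ ^ m * Real.exp (K - c * ‖x‖ ^ 2) := by gcongr; exact h x
    _ = Real.exp K * (‖x‖ ^ m * Real.exp (-(c * ‖x‖ ^ 2))) := by
        rw [sub_eq_add_neg, Real.exp_add]; ring
    _ ≤ _ := mul_le_mul_of_nonneg_left (pow_mul_exp_neg_mul_sq_le m hc (norm_nonneg x))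
        (Real.exp_pos K).le

variable {V : Type*} [NormedAddCommGroup V] [InnerProductSpace ℝ V]

theorem hasTemperateGrowth_neg_mul_norm_sq (p : ℝ) :
    (fun x : V => (-(p * ‖x‖ ^ 2) : ℂ)).HasTemperateGrowth := by
  have h1 : (fun x : V => ((‖x‖ ^ 2 : ℝ) : ℂ)).HasTemperateGrowth :=
    Function.Complex.hasTemperateGrowth_ofReal.comp (Function.hasTemperateGrowth_norm_sq V)
  simpa using (Function.HasTemperateGrowth.const (-p : ℂ)).fun_mul h1

theorem hasTemperateGrowth_inner_ofReal (y : V) :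
    (fun x : V => (⟪y, x⟫ : ℂ)).HasTemperateGrowth :=
  Function.Complex.hasTemperateGrowth_ofReal.comp (Function.hasTemperateGrowth_inner_right y)

theorem gaussianBound_inner (y : V) {p : ℝ} (hp : 0 < p) :
    GaussianBound (fun x : V => (2 * p * ⟪y, x⟫ : ℂ)) (fun x => (-(p * ‖x‖ ^ 2) : ℂ)) := by
  refine .of_le (8 * p * ‖y‖ ^ 2) (half_pos hp) fun x => ?_
  have h1 : ‖(2 * p * ⟪y, x⟫ : ℂ)‖ = 2 * p * |⟪y, x⟫| := by
    simp [abs_of_pos hp]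
  have h2 : (-(p * ‖x‖ ^ 2) : ℂ).re = -(p * ‖x‖ ^ 2) := by
    rw [← Complex.ofReal_pow, ← Complex.ofReal_mul, ← Complex.ofReal_neg, Complex.ofReal_re]
  rw [h1, h2]
  have h3 := abs_real_inner_le_norm y x
  have h4 : p * |⟪y, x⟫| ≤ p * (‖y‖ * ‖x‖) := by gcongr
  nlinarith [mul_nonneg hp.le (sq_nonneg (4 * ‖y‖ - ‖x‖))]

theorem gaussianBound_neg_mul_norm_sq {p : ℝ} (hp : 0 < p) :
    GaussianBound (fun _ : V => 0) (fun x => (-(p * ‖x‖ ^ 2) : ℂ)) :=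
  (gaussianBound_inner (0 : V) hp).zero_left

theorem evalAt_gaussian_sub_eq_zero (f : 𝓢(V, ℂ) →L[ℂ] ℂ) {p : ℝ} (hp : 0 < p) (y : V)
    (h : ∀ k : ℕ, evalAt f (fun x => Complex.exp (-(p * ‖x‖ ^ 2)) * (⟪y, x⟫ : ℂ) ^ k) = 0) :
    evalAt f (fun x => Complex.exp (-(p * ‖x - y‖ ^ 2))) = 0 := by
  have hq : (fun x : V => (2 * p * ⟪y, x⟫ : ℂ)).HasTemperateGrowth :=
    (Function.HasTemperateGrowth.const (2 * p : ℂ)).fun_mul (hasTemperateGrowth_inner_ofReal y)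
  have hQ := hasTemperateGrowth_neg_mul_norm_sq (V := V) p
  have H := gaussianBound_inner y hp
  have h1 := evalAt_exp_mul_exp_eq_zero f hq hQ (.const 1) H fun j => by
    have e : (fun x : V => Complex.exp (-(p * ‖x‖ ^ 2)) * ((2 * p * ⟪y, x⟫ : ℂ) ^ j * 1)) =
        fun x => (2 * p : ℂ) ^ j * (Complex.exp (-(p * ‖x‖ ^ 2)) * (⟪y, x⟫ : ℂ) ^ j) := by
      funext x; ring
    rw [e, evalAt_const_mul, h, mul_zero]
    exact isSchwartz_exp_mul hQ ((hasTemperateGrowth_inner_ofReal y).pow j) H.zero_left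
  have e : (fun x : V => Complex.exp (-(p * ‖x - y‖ ^ 2))) = fun x =>
      Complex.exp (-(p * ‖y‖ ^ 2)) *
        (Complex.exp (2 * p * ⟪y, x⟫) * Complex.exp (-(p * ‖x‖ ^ 2)) * 1) := by
    funext x
    rw [mul_one, ← Complex.exp_add, ← Complex.exp_add]
    congr 1
    have := norm_sub_sq_real x y
    rw [real_inner_comm] at this
    rw [← Complex.ofReal_pow, this]
    push_cast
    ring
  rw [e, evalAt_const_mul, h1, mul_zero]
  have := isSchwartz_expRem hq hQ (.const 1) H 0 zero_le_one le_rfl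
  simpa [expRem_zero] using this

variable [FiniteDimensional ℝ V] [MeasurableSpace V] [BorelSpace V]

theorem eq_zero_of_forall_integral_gaussian_mul_eq_zero {h : V → ℂ} (hcont : Continuous h)
    (hint : Integrable fun x => Complex.exp (-‖x‖ ^ 2) * h x)
    (h0 : ∀ p : ℝ, 0 < p → ∫ x, Complex.exp (-(p * ‖x‖ ^ 2)) * h x = 0) : h 0 = 0 := by
  have hφ : ∫ x : V, Real.exp (-Real.pi * ‖x‖ ^ 2) = 1 := by
    rw [GaussianFourier.integral_rexp_neg_mul_sq_norm Real.pi_pos, div_self Real.pi_ne_zero,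
      Real.one_rpow]
  have hdecay : Filter.Tendsto
      (fun x : V => ‖x‖ ^ Module.finrank ℝ V * Real.exp (-Real.pi * ‖x‖ ^ 2))
      (Bornology.cobounded V) (nhds 0) := by
    have h1 : Filter.Tendsto (fun x : V =>
        ((Module.finrank ℝ V + 1).factorial * Real.exp (1 / (4 * Real.pi))) * ‖x‖⁻¹)
        (Bornology.cobounded V) (nhds (_ * 0)) :=
      (tendsto_inv_atTop_zero.comp tendsto_norm_cobounded_atTop).const_mul _
    rw [mul_zero] at h1
    refine squeeze_zero' (.of_forall fun x => by positivity) ?_ h1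
    filter_upwards [tendsto_norm_cobounded_atTop.eventually_gt_atTop 0] with x hx
    have := pow_mul_exp_neg_mul_sq_le (Module.finrank ℝ V + 1) Real.pi_pos (norm_nonneg x)
    rw [← div_eq_mul_inv, le_div_iff₀ hx]
    rw [pow_succ] at this
    rw [neg_mul]
    linarith
  have key := tendsto_integral_comp_smul_smul_of_integrable (μ := volume)
    (fun x : V => (Real.exp_pos (-Real.pi * ‖x‖ ^ 2)).le) hφ hdecay hint
    (Continuous.continuousAt (by fun_prop))
  have hz : ∀ c : ℝ, ∫ x : V, (c ^ Module.finrank ℝ V * Real.exp (-Real.pi * ‖c • x‖ ^ 2)) •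
      (Complex.exp (-‖x‖ ^ 2) * h x) = 0 := fun c => by
    have e : ∀ x : V, (c ^ Module.finrank ℝ V * Real.exp (-Real.pi * ‖c • x‖ ^ 2)) •
        (Complex.exp (-‖x‖ ^ 2) * h x) = (c : ℂ) ^ Module.finrank ℝ V *
          (Complex.exp (-((Real.pi * c ^ 2 + 1 : ℝ) * ‖x‖ ^ 2)) * h x) := fun x => by
      have h2 : Complex.exp (-((Real.pi * c ^ 2 + 1 : ℝ) * ‖x‖ ^ 2)) =
          Complex.exp (-Real.pi * (c ^ 2 * ‖x‖ ^ 2)) * Complex.exp (-‖x‖ ^ 2) := by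
        rw [← Complex.exp_add]
        congr 1
        push_cast
        ring
      rw [norm_smul, mul_pow, Real.norm_eq_abs, sq_abs, Complex.real_smul, h2]
      push_cast
      ring
    simp_rw [e]
    rw [integral_const_mul, h0 _ (by positivity), mul_zero]
  simp_rw [hz] at key
  simpa using (tendsto_nhds_unique key tendsto_const_nhds)

/-- A tempered distribution vanishing on all products of a centred Gaussian with a power of a linear
form is zero. -/
theorem eq_zero_of_evalAt_gaussian_mul_inner_pow_eq_zero (f : 𝓢(V, ℂ) →L[ℂ] ℂ)
    (h : ∀ (p : ℝ) (_ : 0 < p) (y : V) (k : ℕ),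
      evalAt f (fun x => Complex.exp (-(p * ‖x‖ ^ 2)) * (⟪y, x⟫ : ℂ) ^ k) = 0) : f = 0 := by
  have hG : ∀ p : ℝ, 0 < p →
      ∃ G : 𝓢(V, ℂ), ∀ x, G x = Complex.exp (-(p * ‖x‖ ^ 2)) := fun p hp => by
    obtain ⟨G, hG⟩ := isSchwartz_exp_mul (hasTemperateGrowth_neg_mul_norm_sq (V := V) p)
      (.const 1) (gaussianBound_neg_mul_norm_sq hp)
    exact ⟨G, fun x => by simp [hG]⟩
  ext φ
  have hφ : f φ = f (SchwartzMap.compSubConstCLM ℂ 0 φ) := by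
    rw [SchwartzMap.compSubConstCLM_zero]
    rfl
  rw [hφ]
  refine eq_zero_of_forall_integral_gaussian_mul_eq_zero
    (h := fun y => f (SchwartzMap.compSubConstCLM ℂ y φ))
    (SchwartzMap.continuous_apply_compSubConstCLM f φ) ?_ fun p hp => ?_
  · obtain ⟨G, hG⟩ := hG 1 one_pos
    simpa [hG] using SchwartzMap.integrable_mul_apply_compSubConstCLM f G φ
  · obtain ⟨G, hG⟩ := hG p hp
    simp_rw [← hG]
    rw [← SchwartzMap.apply_convolution_mul, SchwartzMap.convolution_mul_comm,
      SchwartzMap.apply_convolution_mul]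
    refine integral_eq_zero_of_ae (.of_forall fun y => ?_)
    have h1 := evalAt_gaussian_sub_eq_zero f hp y (h p hp y)
    have h2 : (fun x => Complex.exp (-(p * ‖x - y‖ ^ 2))) =
        ⇑(SchwartzMap.compSubConstCLM ℂ y G) := by
      funext x
      rw [SchwartzMap.compSubConstCLM_apply, hG]
    rw [h2, evalAt_coe] at h1
    simp [h1]

end Density

section HyperbolicPlane

variable {𝕂 : Type*} [RCLike 𝕂]

/-- The canonical embedding of `𝕂 = ℝ` or `ℂ` into `ℂ`. -/
noncomputable def complexCoord (x : 𝕂) : ℂ := RCLike.re x + RCLike.im x * Complex.I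

theorem complexCoord_re (x : 𝕂) : (complexCoord x).re = RCLike.re x := by simp [complexCoord]

theorem complexCoord_im (x : 𝕂) : (complexCoord x).im = RCLike.im x := by simp [complexCoord]

theorem complexCoord_mul (x y : 𝕂) : complexCoord (x * y) = complexCoord x * complexCoord y := by
  apply Complex.ext <;> simp [complexCoord_re, complexCoord_im]

theorem complexCoord_mul_conj (x : 𝕂) :
    complexCoord x * starRingEnd ℂ (complexCoord x) = (‖x‖ : ℂ) ^ 2 := by
  rw [Complex.mul_conj, ← Complex.ofReal_pow, RCLike.norm_sq_eq_def, Complex.normSq_apply,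
    complexCoord_re, complexCoord_im]

theorem hasTemperateGrowth_complexCoord : (complexCoord : 𝕂 → ℂ).HasTemperateGrowth := by
  have h : (complexCoord : 𝕂 → ℂ) =
      ⇑(Complex.ofRealCLM ∘L RCLike.reCLM + (Complex.ofRealCLM ∘L RCLike.imCLM).smulRight
        Complex.I : 𝕂 →L[ℝ] ℂ) := by
    ext x
    simp [complexCoord]
  rw [h]
  exact ContinuousLinearMap.hasTemperateGrowth _

theorem Function.HasTemperateGrowth.conj {E : Type*} [NormedAddCommGroup E] [NormedSpace ℝ E]
    {u : E → ℂ} (hu : u.HasTemperateGrowth) :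
    (fun x => starRingEnd ℂ (u x)).HasTemperateGrowth :=
  (Complex.conjCLE.toContinuousLinearMap.hasTemperateGrowth).comp hu

theorem Function.HasTemperateGrowth.comp_fst {u : 𝕂 → ℂ} (hu : u.HasTemperateGrowth) :
    (fun v : 𝕂 × 𝕂 => u v.1).HasTemperateGrowth :=
  hu.comp (ContinuousLinearMap.fst ℝ 𝕂 𝕂).hasTemperateGrowth

theorem Function.HasTemperateGrowth.comp_snd {u : 𝕂 → ℂ} (hu : u.HasTemperateGrowth) :
    (fun v : 𝕂 × 𝕂 => u v.2).HasTemperateGrowth :=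
  hu.comp (ContinuousLinearMap.snd ℝ 𝕂 𝕂).hasTemperateGrowth

theorem Function.HasTemperateGrowth.comp_mul {u : 𝕂 → ℂ} (hu : u.HasTemperateGrowth) :
    (fun v : 𝕂 × 𝕂 => u (v.1 * v.2)).HasTemperateGrowth :=
  hu.comp ((ContinuousLinearMap.mul ℝ 𝕂).bilinear_hasTemperateGrowth
    (ContinuousLinearMap.fst ℝ 𝕂 𝕂).hasTemperateGrowth
    (ContinuousLinearMap.snd ℝ 𝕂 𝕂).hasTemperateGrowth)

theorem hasTemperateGrowth_norm_sq_ofReal :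
    (fun x : 𝕂 => (‖x‖ : ℂ) ^ 2).HasTemperateGrowth := by
  simp_rw [← complexCoord_mul_conj]
  exact hasTemperateGrowth_complexCoord.fun_mul hasTemperateGrowth_complexCoord.conj

/-- The exponent of an anisotropic Gaussian on `𝕂 × 𝕂`. -/
noncomputable def gaussExponent (p r : ℝ) (v : 𝕂 × 𝕂) : ℂ :=
  -(p * (‖v.1‖ : ℂ) ^ 2 + r * (‖v.2‖ : ℂ) ^ 2)

theorem gaussExponent_re (p r : ℝ) (v : 𝕂 × 𝕂) :
    (gaussExponent p r v).re = -(p * ‖v.1‖ ^ 2 + r * ‖v.2‖ ^ 2) := by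
  have : gaussExponent p r v = ((-(p * ‖v.1‖ ^ 2 + r * ‖v.2‖ ^ 2) : ℝ) : ℂ) := by
    simp [gaussExponent]
  rw [this, Complex.ofReal_re]

theorem hasTemperateGrowth_gaussExponent (p r : ℝ) :
    (gaussExponent p r : 𝕂 × 𝕂 → ℂ).HasTemperateGrowth :=
  ((Function.HasTemperateGrowth.const (p : ℂ)).fun_mul
    hasTemperateGrowth_norm_sq_ofReal.comp_fst |>.fun_add
      ((Function.HasTemperateGrowth.const (r : ℂ)).fun_mul
        hasTemperateGrowth_norm_sq_ofReal.comp_snd)).fun_neg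

theorem norm_sq_le_add (v : 𝕂 × 𝕂) : ‖v‖ ^ 2 ≤ ‖v.1‖ ^ 2 + ‖v.2‖ ^ 2 := by
  rw [Prod.norm_def]
  rcases max_cases ‖v.1‖ ‖v.2‖ with h | h <;> rw [h.1] <;> nlinarith

theorem gaussianBound_gaussExponent_of_le {p r : ℝ} (hp : 0 < p) (hr : 0 < r) {q : 𝕂 × 𝕂 → ℂ}
    (hq : ∀ v, 4 * ‖q v‖ ≤ p * ‖v.1‖ ^ 2 + r * ‖v.2‖ ^ 2) :
    GaussianBound q (gaussExponent p r) := by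
  refine .of_le 0 (half_pos (lt_min hp hr)) fun v => ?_
  rw [gaussExponent_re]
  have h1 := hq v
  have h2 : min p r * ‖v‖ ^ 2 ≤ p * ‖v.1‖ ^ 2 + r * ‖v.2‖ ^ 2 := by
    calc min p r * ‖v‖ ^ 2 ≤ min p r * (‖v.1‖ ^ 2 + ‖v.2‖ ^ 2) := by
          gcongr; exact norm_sq_le_add v
      _ = min p r * ‖v.1‖ ^ 2 + min p r * ‖v.2‖ ^ 2 := mul_add _ _ _
      _ ≤ _ := by gcongr; exacts [min_le_left _ _, min_le_right _ _]
  linarith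

theorem isSchwartz_exp_gaussExponent_mul {p r : ℝ} (hp : 0 < p) (hr : 0 < r) {P : 𝕂 × 𝕂 → ℂ}
    (hP : P.HasTemperateGrowth) :
    IsSchwartz fun v => Complex.exp (gaussExponent p r v) * P v :=
  isSchwartz_exp_mul (hasTemperateGrowth_gaussExponent p r) hP
    (gaussianBound_gaussExponent_of_le hp hr fun v => by simp; positivity)

variable {f : 𝓢(𝕂 × 𝕂, ℂ) →L[ℂ] ℂ}

theorem evalAt_eq_of_invariant
    (hinv : ∀ (a : 𝕂ˣ) (φ φ' : 𝓢(𝕂 × 𝕂, ℂ)),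
      (∀ p : 𝕂 × 𝕂, φ' p = φ ((a : 𝕂) * p.1, ((a⁻¹ : 𝕂ˣ) : 𝕂) * p.2)) → f φ' = f φ)
    (a : 𝕂ˣ) {u u' : 𝕂 × 𝕂 → ℂ} (hu : IsSchwartz u) (hu' : IsSchwartz u')
    (h : ∀ v, u' v = u ((a : 𝕂) * v.1, ((a⁻¹ : 𝕂ˣ) : 𝕂) * v.2)) :
    evalAt f u' = evalAt f u := by
  obtain ⟨φ, rfl⟩ := hu
  obtain ⟨φ', rfl⟩ := hu'
  rw [evalAt_coe, evalAt_coe]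
  exact hinv a φ φ' h

theorem evalAt_eq_neg_of_skew
    (hskew : ∀ φ φ' : 𝓢(𝕂 × 𝕂, ℂ), (∀ p : 𝕂 × 𝕂, φ' p = φ (p.2, p.1)) → f φ' = - f φ)
    {u u' : 𝕂 × 𝕂 → ℂ} (hu : IsSchwartz u) (hu' : IsSchwartz u')
    (h : ∀ v, u' v = u (v.2, v.1)) : evalAt f u' = -evalAt f u := by
  obtain ⟨φ, rfl⟩ := hu
  obtain ⟨φ', rfl⟩ := hu'
  rw [evalAt_coe, evalAt_coe]
  exact hskew φ φ' h

theorem evalAt_gaussExponent_swap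
    (hinv : ∀ (a : 𝕂ˣ) (φ φ' : 𝓢(𝕂 × 𝕂, ℂ)),
      (∀ p : 𝕂 × 𝕂, φ' p = φ ((a : 𝕂) * p.1, ((a⁻¹ : 𝕂ˣ) : 𝕂) * p.2)) → f φ' = f φ)
    {U : 𝕂 → ℂ} (hU : U.HasTemperateGrowth) {p r : ℝ} (hp : 0 < p) (hr : 0 < r) :
    evalAt f (fun v => Complex.exp (gaussExponent p r v) * U (v.1 * v.2)) =
      evalAt f (fun v => Complex.exp (gaussExponent r p v) * U (v.1 * v.2)) := by
  have hs : 0 < √(r / p) := Real.sqrt_pos.2 (by positivity)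
  have ha : ((√(r / p) : ℝ) : 𝕂) ≠ 0 := by exact_mod_cast hs.ne'
  refine (evalAt_eq_of_invariant hinv (Units.mk0 _ ha)
    (isSchwartz_exp_gaussExponent_mul hp hr hU.comp_mul)
    (isSchwartz_exp_gaussExponent_mul hr hp hU.comp_mul) fun v => ?_).symm
  have h1 : ((Units.mk0 _ ha : 𝕂ˣ) : 𝕂) = ((√(r / p) : ℝ) : 𝕂) := rfl
  have h2 : (((Units.mk0 _ ha)⁻¹ : 𝕂ˣ) : 𝕂) = ((√(r / p) : ℝ) : 𝕂)⁻¹ := by simp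
  simp only [h1, h2]
  have h3 : ((√(r / p) : ℝ) : 𝕂) * v.1 * (((√(r / p) : ℝ) : 𝕂)⁻¹ * v.2) = v.1 * v.2 := by
    field_simp
  rw [h3]
  congr 2
  have hsq : √(r / p) ^ 2 = r / p := Real.sq_sqrt (by positivity)
  have h4 : p * (√(r / p) * ‖v.1‖) ^ 2 = r * ‖v.1‖ ^ 2 := by
    rw [mul_pow, hsq]; field_simp
  have h5 : r * ((√(r / p))⁻¹ * ‖v.2‖) ^ 2 = p * ‖v.2‖ ^ 2 := by
    rw [mul_pow, inv_pow, hsq]; field_simp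
  simp only [gaussExponent, norm_mul, norm_inv, RCLike.norm_ofReal, abs_of_pos hs]
  norm_cast
  rw [h4, h5]

theorem evalAt_gaussExponent_mul_norm_pow_swap
    (hinv : ∀ (a : 𝕂ˣ) (φ φ' : 𝓢(𝕂 × 𝕂, ℂ)),
      (∀ p : 𝕂 × 𝕂, φ' p = φ ((a : 𝕂) * p.1, ((a⁻¹ : 𝕂ˣ) : 𝕂) * p.2)) → f φ' = f φ)
    {U : 𝕂 → ℂ} (hU : U.HasTemperateGrowth) (i j : ℕ) {p r : ℝ} (hp : 0 < p) (hr : 0 < r) :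
    evalAt f (fun v => Complex.exp (gaussExponent p r v) *
        (((‖v.1‖ : ℂ) ^ 2) ^ i * ((‖v.2‖ : ℂ) ^ 2) ^ j * U (v.1 * v.2))) =
      evalAt f (fun v => Complex.exp (gaussExponent r p v) *
        (((‖v.2‖ : ℂ) ^ 2) ^ i * ((‖v.1‖ : ℂ) ^ 2) ^ j * U (v.1 * v.2))) := by
  have t1 : (fun v : 𝕂 × 𝕂 => (‖v.1‖ : ℂ) ^ 2).HasTemperateGrowth :=
    hasTemperateGrowth_norm_sq_ofReal.comp_fst
  have t2 : (fun v : 𝕂 × 𝕂 => (‖v.2‖ : ℂ) ^ 2).HasTemperateGrowth :=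
    hasTemperateGrowth_norm_sq_ofReal.comp_snd
  have tU := hU.comp_mul
  have step : ∀ i j : ℕ, (∀ p r : ℝ, 0 < p → 0 < r →
      evalAt f (fun v => Complex.exp (gaussExponent p r v) *
          (((‖v.1‖ : ℂ) ^ 2) ^ i * ((‖v.2‖ : ℂ) ^ 2) ^ j * U (v.1 * v.2))) =
        evalAt f (fun v => Complex.exp (gaussExponent r p v) *
          (((‖v.2‖ : ℂ) ^ 2) ^ i * ((‖v.1‖ : ℂ) ^ 2) ^ j * U (v.1 * v.2)))) →
      ∀ p r : ℝ, 0 < p → 0 < r →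
      evalAt f (fun v => Complex.exp (gaussExponent p r v) *
          (((‖v.1‖ : ℂ) ^ 2) ^ (i + 1) * ((‖v.2‖ : ℂ) ^ 2) ^ j * U (v.1 * v.2))) =
        evalAt f (fun v => Complex.exp (gaussExponent r p v) *
          (((‖v.2‖ : ℂ) ^ 2) ^ (i + 1) * ((‖v.1‖ : ℂ) ^ 2) ^ j * U (v.1 * v.2))) := by
    intro i j ih p r hp hr
    have tP : (fun v : 𝕂 × 𝕂 => ((‖v.1‖ : ℂ) ^ 2) ^ i * ((‖v.2‖ : ℂ) ^ 2) ^ j *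
        U (v.1 * v.2)).HasTemperateGrowth := ((t1.fun_pow i).fun_mul (t2.fun_pow j)).fun_mul tU
    have tP' : (fun v : 𝕂 × 𝕂 => ((‖v.2‖ : ℂ) ^ 2) ^ i * ((‖v.1‖ : ℂ) ^ 2) ^ j *
        U (v.1 * v.2)).HasTemperateGrowth := ((t2.fun_pow i).fun_mul (t1.fun_pow j)).fun_mul tU
    have tq := (Function.HasTemperateGrowth.const (-(p / 4 : ℝ) : ℂ)).fun_mul t1
    have tq' := (Function.HasTemperateGrowth.const (-(p / 4 : ℝ) : ℂ)).fun_mul t2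
    have nq : ∀ x : 𝕂, 4 * ‖(-(p / 4 : ℝ) : ℂ) * (‖x‖ : ℂ) ^ 2‖ = p * ‖x‖ ^ 2 := fun x => by
      rw [norm_mul, norm_neg, norm_pow, Complex.norm_real, Complex.norm_real,
        Real.norm_of_nonneg (by positivity), norm_norm]
      ring
    have H := gaussianBound_gaussExponent_of_le hp hr
      (q := fun v : 𝕂 × 𝕂 => (-(p / 4 : ℝ) : ℂ) * (‖v.1‖ : ℂ) ^ 2) fun v => by
        rw [nq]; have : 0 ≤ r * ‖v.2‖ ^ 2 := by positivity
        linarith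
    have H' := gaussianBound_gaussExponent_of_le hr hp
      (q := fun v : 𝕂 × 𝕂 => (-(p / 4 : ℝ) : ℂ) * (‖v.2‖ : ℂ) ^ 2) fun v => by
        rw [nq]; have : 0 ≤ r * ‖v.1‖ ^ 2 := by positivity
        linarith
    have key := evalAt_mul_eq_of_exp_eq f tq (hasTemperateGrowth_gaussExponent p r) tP H
      tq' (hasTemperateGrowth_gaussExponent r p) tP' H' fun t ht0 ht1 => by
        convert ih (p + t * (p / 4)) r (by positivity) hr using 3 with v v
        · rw [← Complex.exp_add]
          congr 2
          simp only [gaussExponent]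
          push_cast
          ring
        · rw [← Complex.exp_add]
          congr 2
          simp only [gaussExponent]
          push_cast
          ring
    have hc : (-(p / 4 : ℝ) : ℂ) ≠ 0 := neg_ne_zero.2 (by exact_mod_cast (by positivity : p / 4 ≠ 0))
    refine mul_left_cancel₀ hc ?_
    rw [← evalAt_const_mul, ← evalAt_const_mul]
    · convert key using 3 <;> ring
    · exact isSchwartz_exp_gaussExponent_mul hr hp
        (((t2.fun_pow _).fun_mul (t1.fun_pow j)).fun_mul tU)
    · exact isSchwartz_exp_gaussExponent_mul hp hr
        (((t1.fun_pow _).fun_mul (t2.fun_pow j)).fun_mul tU)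
  have h0 : ∀ i, ∀ p r : ℝ, 0 < p → 0 < r →
      evalAt f (fun v => Complex.exp (gaussExponent p r v) *
          (((‖v.1‖ : ℂ) ^ 2) ^ i * ((‖v.2‖ : ℂ) ^ 2) ^ 0 * U (v.1 * v.2))) =
        evalAt f (fun v => Complex.exp (gaussExponent r p v) *
          (((‖v.2‖ : ℂ) ^ 2) ^ i * ((‖v.1‖ : ℂ) ^ 2) ^ 0 * U (v.1 * v.2))) := by
    intro i
    induction i with
    | zero => intro p r hp hr; simpa using evalAt_gaussExponent_swap hinv hU hp hr
    | succ i ih => exact step i 0 ih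
  have h1 : ∀ i, ∀ p r : ℝ, 0 < p → 0 < r →
      evalAt f (fun v => Complex.exp (gaussExponent p r v) *
          (((‖v.1‖ : ℂ) ^ 2) ^ i * ((‖v.2‖ : ℂ) ^ 2) ^ j * U (v.1 * v.2))) =
        evalAt f (fun v => Complex.exp (gaussExponent r p v) *
          (((‖v.2‖ : ℂ) ^ 2) ^ i * ((‖v.1‖ : ℂ) ^ 2) ^ j * U (v.1 * v.2))) := by
    intro i
    induction i with
    | zero => intro p r hp hr; simpa using (h0 j r p hr hp).symm
    | succ i ih => exact step i j ih
  exact h1 i p r hp hr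

theorem evalAt_gaussExponent_mul_norm_pow_eq_zero
    (hinv : ∀ (a : 𝕂ˣ) (φ φ' : 𝓢(𝕂 × 𝕂, ℂ)),
      (∀ p : 𝕂 × 𝕂, φ' p = φ ((a : 𝕂) * p.1, ((a⁻¹ : 𝕂ˣ) : 𝕂) * p.2)) → f φ' = f φ)
    (hskew : ∀ φ φ' : 𝓢(𝕂 × 𝕂, ℂ), (∀ p : 𝕂 × 𝕂, φ' p = φ (p.2, p.1)) → f φ' = - f φ)
    {U : 𝕂 → ℂ} (hU : U.HasTemperateGrowth) (i j : ℕ) {p : ℝ} (hp : 0 < p) :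
    evalAt f (fun v => Complex.exp (gaussExponent p p v) *
        (((‖v.1‖ : ℂ) ^ 2) ^ i * ((‖v.2‖ : ℂ) ^ 2) ^ j * U (v.1 * v.2))) = 0 := by
  have t1 : (fun v : 𝕂 × 𝕂 => (‖v.1‖ : ℂ) ^ 2).HasTemperateGrowth :=
    hasTemperateGrowth_norm_sq_ofReal.comp_fst
  have t2 : (fun v : 𝕂 × 𝕂 => (‖v.2‖ : ℂ) ^ 2).HasTemperateGrowth :=
    hasTemperateGrowth_norm_sq_ofReal.comp_snd
  have h1 := evalAt_gaussExponent_mul_norm_pow_swap hinv hU i j hp hp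
  have h2 := evalAt_eq_neg_of_skew hskew
    (isSchwartz_exp_gaussExponent_mul hp hp
      (((t1.fun_pow i).fun_mul (t2.fun_pow j)).fun_mul hU.comp_mul))
    (isSchwartz_exp_gaussExponent_mul hp hp
      (((t2.fun_pow i).fun_mul (t1.fun_pow j)).fun_mul hU.comp_mul)) fun v => by
    simp only [gaussExponent]
    rw [mul_comm v.2 v.1, add_comm]
  exact self_eq_neg.1 (h1.trans h2)

theorem isSchwartz_exp_gaussExponent_mul_monomial {p : ℝ} (hp : 0 < p) (a b c d : ℕ) :
    IsSchwartz fun v : 𝕂 × 𝕂 => Complex.exp (gaussExponent p p v) *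
      (complexCoord v.1 ^ a * starRingEnd ℂ (complexCoord v.1) ^ b *
        complexCoord v.2 ^ c * starRingEnd ℂ (complexCoord v.2) ^ d) := by
  have t1 := (hasTemperateGrowth_complexCoord (𝕂 := 𝕂)).comp_fst
  have t2 := (hasTemperateGrowth_complexCoord (𝕂 := 𝕂)).comp_snd
  exact isSchwartz_exp_gaussExponent_mul hp hp ((((t1.fun_pow a).fun_mul
    (t1.conj.fun_pow b)).fun_mul (t2.fun_pow c)).fun_mul (t2.conj.fun_pow d))

theorem evalAt_monomial_eq_zero_of_unit
    (hinv : ∀ (a : 𝕂ˣ) (φ φ' : 𝓢(𝕂 × 𝕂, ℂ)),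
      (∀ p : 𝕂 × 𝕂, φ' p = φ ((a : 𝕂) * p.1, ((a⁻¹ : 𝕂ˣ) : 𝕂) * p.2)) → f φ' = f φ)
    {p : ℝ} (hp : 0 < p) (a b c d : ℕ) (e : 𝕂ˣ) (he : ‖(e : 𝕂)‖ = 1)
    (h : complexCoord (e : 𝕂) ^ a * starRingEnd ℂ (complexCoord (e : 𝕂)) ^ b *
      complexCoord ((e⁻¹ : 𝕂ˣ) : 𝕂) ^ c *
      starRingEnd ℂ (complexCoord ((e⁻¹ : 𝕂ˣ) : 𝕂)) ^ d = -1) :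
    evalAt f (fun v => Complex.exp (gaussExponent p p v) *
      (complexCoord v.1 ^ a * starRingEnd ℂ (complexCoord v.1) ^ b *
        complexCoord v.2 ^ c * starRingEnd ℂ (complexCoord v.2) ^ d)) = 0 := by
  have hs := isSchwartz_exp_gaussExponent_mul_monomial (𝕂 := 𝕂) hp a b c d
  have h1 := evalAt_eq_of_invariant hinv e hs (hs.const_mul (-1)) fun v => by
    have h2 : gaussExponent p p ((e : 𝕂) * v.1, ((e⁻¹ : 𝕂ˣ) : 𝕂) * v.2) = gaussExponent p p v := by
      simp [gaussExponent, he]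
    simp only [h2, complexCoord_mul, map_mul, mul_pow]
    rw [← h]
    ring
  rw [evalAt_const_mul f hs, neg_one_mul] at h1
  exact self_eq_neg.1 h1.symm

theorem evalAt_monomial_eq_zero_of_I_eq_zero (hI : (RCLike.I : 𝕂) = 0)
    (hinv : ∀ (a : 𝕂ˣ) (φ φ' : 𝓢(𝕂 × 𝕂, ℂ)),
      (∀ p : 𝕂 × 𝕂, φ' p = φ ((a : 𝕂) * p.1, ((a⁻¹ : 𝕂ˣ) : 𝕂) * p.2)) → f φ' = f φ)
    (hskew : ∀ φ φ' : 𝓢(𝕂 × 𝕂, ℂ), (∀ p : 𝕂 × 𝕂, φ' p = φ (p.2, p.1)) → f φ' = - f φ)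
    {p : ℝ} (hp : 0 < p) (a b c d : ℕ) :
    evalAt f (fun v => Complex.exp (gaussExponent p p v) *
      (complexCoord v.1 ^ a * starRingEnd ℂ (complexCoord v.1) ^ b *
        complexCoord v.2 ^ c * starRingEnd ℂ (complexCoord v.2) ^ d)) = 0 := by
  have hconj : ∀ x : 𝕂, starRingEnd ℂ (complexCoord x) = complexCoord x := fun x => by
    have : RCLike.im x = 0 := by
      have h := RCLike.mul_im_I_ax x
      simpa [hI] using h.symm
    simp [complexCoord, this]
  have hsq : ∀ x : 𝕂, (‖x‖ : ℂ) ^ 2 = complexCoord x ^ 2 := fun x => by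
    rw [← complexCoord_mul_conj, hconj, sq]
  rcases Nat.even_or_odd (a + b + (c + d)) with hpar | hpar
  · obtain ⟨i, j, e, h1, h2⟩ : ∃ i j e, a + b = 2 * i + e ∧ c + d = 2 * j + e := by
      refine ⟨(a + b) / 2, (c + d) / 2, (a + b) % 2, ?_, ?_⟩ <;>
        obtain ⟨r, hr⟩ := hpar <;> omega
    have h := evalAt_gaussExponent_mul_norm_pow_eq_zero hinv hskew
      ((hasTemperateGrowth_complexCoord (𝕂 := 𝕂)).fun_pow e) i j hp
    convert h using 3 with v
    rw [hconj, hconj, hsq, hsq, complexCoord_mul, ← pow_mul, ← pow_mul, ← pow_add, mul_assoc,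
      ← pow_add, h1, h2]
    ring
  · refine evalAt_monomial_eq_zero_of_unit hinv hp a b c d (-1) (by simp) ?_
    have h1 : complexCoord (-1 : 𝕂) = -1 := by simp [complexCoord]
    simp only [inv_neg, inv_one, Units.val_neg, Units.val_one, h1, map_neg, map_one]
    rw [← pow_add, mul_assoc, ← pow_add, ← pow_add, hpar.neg_one_pow]

theorem complexCoord_cos_add_sin_mul_I (hI : RCLike.im (RCLike.I : 𝕂) = 1) (θ : ℝ) :
    complexCoord ((Real.cos θ : 𝕂) + (Real.sin θ : 𝕂) * RCLike.I) = Complex.exp (θ * Complex.I) := by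
  rw [Complex.exp_mul_I]
  simp [complexCoord, hI]

theorem evalAt_monomial_eq_zero_of_ne (hI : RCLike.im (RCLike.I : 𝕂) = 1)
    (hinv : ∀ (a : 𝕂ˣ) (φ φ' : 𝓢(𝕂 × 𝕂, ℂ)),
      (∀ p : 𝕂 × 𝕂, φ' p = φ ((a : 𝕂) * p.1, ((a⁻¹ : 𝕂ˣ) : 𝕂) * p.2)) → f φ' = f φ)
    {p : ℝ} (hp : 0 < p) (a b c d : ℕ) (hne : a + d ≠ b + c) :
    evalAt f (fun v => Complex.exp (gaussExponent p p v) *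
      (complexCoord v.1 ^ a * starRingEnd ℂ (complexCoord v.1) ^ b *
        complexCoord v.2 ^ c * starRingEnd ℂ (complexCoord v.2) ^ d)) = 0 := by
  have hn : (a : ℂ) - b - c + d ≠ 0 := fun h => hne (by
    have : (a + d : ℂ) = b + c := by linear_combination h
    exact_mod_cast this)
  set θ : ℝ := Real.pi / (a - b - c + d) with hθ
  set x : 𝕂 := (Real.cos θ : 𝕂) + (Real.sin θ : 𝕂) * RCLike.I
  have hx : complexCoord x = Complex.exp (θ * Complex.I) := complexCoord_cos_add_sin_mul_I hI θ
  have hxc : starRingEnd ℂ (Complex.exp (θ * Complex.I)) = Complex.exp (-(θ * Complex.I)) := by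
    rw [← Complex.exp_conj]
    simp
  have hxn : ‖x‖ = 1 := by
    have h := complexCoord_mul_conj x
    rw [hx, hxc, ← Complex.exp_add, add_neg_cancel, Complex.exp_zero] at h
    have h' : ‖x‖ ^ 2 = 1 := by exact_mod_cast h.symm
    exact (pow_eq_one_iff_of_nonneg (norm_nonneg x) two_ne_zero).1 h'
  have hx0 : x ≠ 0 := norm_ne_zero_iff.1 (by simp [hxn])
  have hxi : complexCoord x⁻¹ = Complex.exp (-(θ * Complex.I)) := by
    have h1 : complexCoord x⁻¹ * complexCoord x = 1 := by
      rw [← complexCoord_mul, inv_mul_cancel₀ hx0]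
      simp [complexCoord]
    rw [Complex.exp_neg, ← hx]
    exact eq_inv_of_mul_eq_one_left h1
  have hxic : starRingEnd ℂ (Complex.exp (-(θ * Complex.I))) = Complex.exp (θ * Complex.I) := by
    rw [← hxc, Complex.conj_conj]
  refine evalAt_monomial_eq_zero_of_unit hinv hp a b c d (Units.mk0 x hx0) hxn ?_
  simp only [Units.val_inv_eq_inv_val, Units.val_mk0]
  rw [hx, hxi, hxc, hxic, ← Complex.exp_nat_mul, ← Complex.exp_nat_mul, ← Complex.exp_nat_mul,
    ← Complex.exp_nat_mul, ← Complex.exp_add, ← Complex.exp_add, ← Complex.exp_add,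
    ← Complex.exp_pi_mul_I]
  congr 1
  rw [hθ]
  push_cast
  field_simp
  ring

theorem evalAt_monomial_eq_zero
    (hinv : ∀ (a : 𝕂ˣ) (φ φ' : 𝓢(𝕂 × 𝕂, ℂ)),
      (∀ p : 𝕂 × 𝕂, φ' p = φ ((a : 𝕂) * p.1, ((a⁻¹ : 𝕂ˣ) : 𝕂) * p.2)) → f φ' = f φ)
    (hskew : ∀ φ φ' : 𝓢(𝕂 × 𝕂, ℂ), (∀ p : 𝕂 × 𝕂, φ' p = φ (p.2, p.1)) → f φ' = - f φ)
    {p : ℝ} (hp : 0 < p) (a b c d : ℕ) :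
    evalAt f (fun v => Complex.exp (gaussExponent p p v) *
      (complexCoord v.1 ^ a * starRingEnd ℂ (complexCoord v.1) ^ b *
        complexCoord v.2 ^ c * starRingEnd ℂ (complexCoord v.2) ^ d)) = 0 := by
  rcases RCLike.I_eq_zero_or_im_I_eq_one (K := 𝕂) with hI | hI
  · exact evalAt_monomial_eq_zero_of_I_eq_zero hI hinv hskew hp a b c d
  by_cases hne : a + d = b + c
  swap
  · exact evalAt_monomial_eq_zero_of_ne hI hinv hp a b c d hne
  have tU := hasTemperateGrowth_complexCoord (𝕂 := 𝕂)
  rcases le_total b a with hab | hab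
  · obtain ⟨m, rfl⟩ := Nat.exists_eq_add_of_le hab
    obtain rfl : c = d + m := by omega
    have h := evalAt_gaussExponent_mul_norm_pow_eq_zero hinv hskew (tU.fun_pow m) b d hp
    convert h using 3 with v
    rw [← complexCoord_mul_conj, ← complexCoord_mul_conj, complexCoord_mul]
    ring
  · obtain ⟨m, rfl⟩ := Nat.exists_eq_add_of_le hab
    obtain rfl : d = c + m := by omega
    have h := evalAt_gaussExponent_mul_norm_pow_eq_zero hinv hskew (tU.conj.fun_pow m) a c hp
    convert h using 3 with v
    rw [← complexCoord_mul_conj, ← complexCoord_mul_conj, complexCoord_mul, map_mul]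
    ring

theorem evalAt_eval_eq_zero
    (hinv : ∀ (a : 𝕂ˣ) (φ φ' : 𝓢(𝕂 × 𝕂, ℂ)),
      (∀ p : 𝕂 × 𝕂, φ' p = φ ((a : 𝕂) * p.1, ((a⁻¹ : 𝕂ˣ) : 𝕂) * p.2)) → f φ' = f φ)
    (hskew : ∀ φ φ' : 𝓢(𝕂 × 𝕂, ℂ), (∀ p : 𝕂 × 𝕂, φ' p = φ (p.2, p.1)) → f φ' = - f φ)
    {p : ℝ} (hp : 0 < p) (P : MvPolynomial (Fin 4) ℂ) :
    evalAt f (fun v => Complex.exp (gaussExponent p p v) *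
      P.eval ![complexCoord v.1, starRingEnd ℂ (complexCoord v.1), complexCoord v.2,
        starRingEnd ℂ (complexCoord v.2)]) = 0 := by
  have hs := fun m : Fin 4 →₀ ℕ =>
    isSchwartz_exp_gaussExponent_mul_monomial (𝕂 := 𝕂) hp (m 0) (m 1) (m 2) (m 3)
  have h1 := evalAt_sum f (s := P.support) fun m _ => (hs m).const_mul (P.coeff m)
  rw [Finset.sum_eq_zero fun m _ => by
    rw [evalAt_const_mul f (hs m), evalAt_monomial_eq_zero hinv hskew hp, mul_zero]] at h1
  convert h1 using 3 with v
  rw [MvPolynomial.eval_eq', Finset.mul_sum]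
  refine Finset.sum_congr rfl fun m _ => ?_
  rw [Fin.prod_univ_four, mul_left_comm]
  rfl

theorem evalAt_comp_compCLMOfContinuousLinearEquiv {D E : Type*} [NormedAddCommGroup D]
    [NormedSpace ℝ D] [NormedAddCommGroup E] [NormedSpace ℝ E] (f : 𝓢(D, ℂ) →L[ℂ] ℂ)
    (e : D ≃L[ℝ] E) {u : E → ℂ} (hu : IsSchwartz u) :
    evalAt (f ∘L SchwartzMap.compCLMOfContinuousLinearEquiv ℂ e) u = evalAt f (u ∘ e) := by
  obtain ⟨φ, rfl⟩ := hu
  rw [evalAt_coe, ContinuousLinearMap.comp_apply, ← evalAt_coe]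
  rfl

theorem real_inner_eq_complexCoord (y x : 𝕂) :
    ((inner ℝ y x : ℝ) : ℂ) = (starRingEnd ℂ (complexCoord y) * complexCoord x +
      complexCoord y * starRingEnd ℂ (complexCoord x)) / 2 := by
  have h : inner ℝ y x = RCLike.re y * RCLike.re x + RCLike.im y * RCLike.im x := by
    change RCLike.re (inner 𝕂 y x) = _
    simp
    ring
  rw [h]
  apply Complex.ext <;> simp [complexCoord_re, complexCoord_im]; ring

end HyperbolicPlane

/-- Let `f` be a tempered distribution on `𝕂 × 𝕂` which is invariant under
`(x,y) ↦ (a·x, a⁻¹·y)` for every `a ∈ 𝕂ˣ`, and anti-invariant under the swap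
`(x,y) ↦ (y,x)`.  Then `f = 0`. -/
theorem hyperbolic_plane_distribution_vanishing {𝕂 : Type*} [RCLike 𝕂]
    (f : SchwartzMap (𝕂 × 𝕂) ℂ →L[ℂ] ℂ)
    (hinv : ∀ (a : 𝕂ˣ) (φ φ' : SchwartzMap (𝕂 × 𝕂) ℂ),
      (∀ p : 𝕂 × 𝕂, φ' p = φ ((a : 𝕂) * p.1, ((a⁻¹ : 𝕂ˣ) : 𝕂) * p.2)) → f φ' = f φ)
    (hskew : ∀ φ φ' : SchwartzMap (𝕂 × 𝕂) ℂ,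
      (∀ p : 𝕂 × 𝕂, φ' p = φ (p.2, p.1)) → f φ' = - f φ) :
    f = 0 := by
  let e := WithLp.prodContinuousLinearEquiv 2 ℝ 𝕂 𝕂
  let _ : MeasurableSpace (WithLp 2 (𝕂 × 𝕂)) := borel _
  have : BorelSpace (WithLp 2 (𝕂 × 𝕂)) := ⟨rfl⟩
  have : FiniteDimensional ℝ (WithLp 2 (𝕂 × 𝕂)) :=
    LinearEquiv.finiteDimensional e.symm.toLinearEquiv
  have hg : f ∘L SchwartzMap.compCLMOfContinuousLinearEquiv ℂ e.symm = 0 := by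
    refine eq_zero_of_evalAt_gaussian_mul_inner_pow_eq_zero _ fun p hp y k => ?_
    rw [evalAt_comp_compCLMOfContinuousLinearEquiv f e.symm
      (isSchwartz_exp_mul (hasTemperateGrowth_neg_mul_norm_sq p)
        ((hasTemperateGrowth_inner_ofReal y).fun_pow k)
        (gaussianBound_neg_mul_norm_sq hp).zero_left)]
    let κ : 𝕂 → ℂ := complexCoord
    have h := evalAt_eval_eq_zero hinv hskew hp
      ((MvPolynomial.C (starRingEnd ℂ (κ y.fst) / 2) * MvPolynomial.X 0 +
        MvPolynomial.C (κ y.fst / 2) * MvPolynomial.X 1 +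
        (MvPolynomial.C (starRingEnd ℂ (κ y.snd) / 2) * MvPolynomial.X 2 +
        MvPolynomial.C (κ y.snd / 2) * MvPolynomial.X 3)) ^ k)
    convert h using 2
    funext v
    simp only [Function.comp_apply]
    congr 2
    · rw [← Complex.ofReal_pow, WithLp.prod_norm_sq_eq_of_L2]
      simp [e, gaussExponent]
      ring
    · rw [WithLp.prod_inner_apply, Complex.ofReal_add, real_inner_eq_complexCoord,
        real_inner_eq_complexCoord]
      simp [e, κ]
      ring
  ext φ
  have h := DFunLike.congr_fun hg (SchwartzMap.compCLMOfContinuousLinearEquiv ℂ e φ)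
  rw [ContinuousLinearMap.comp_apply] at h
  refine Eq.trans (congrArg f ?_) h
  ext v
  simp
end
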